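/- arXiv:2602.18219 — 3 statements merged into one kernel-verified Lean document; each statement's English description precedes it below -/
import Mathlib

section
/- Let K : ℝⁿ → [0,∞) be measurable with K(x₁, x') depending on x' only through |x'| (i.e. K(x₁, Rx') = K(x₁, x') for all orthogonal R), such that for each x₁ the map x' ↦ K(x₁, x') is radially nonincreasing, and K(x₁,·) ∈ L¹(ℝ^{n-1}) for all x₁ ≠ 0. Then for every measurable set E ⊂ ℝⁿ with |E ∩ Ω| < ∞, where Ω = {x : -π < x₁ < π}, the periodic anisotropic nonlocal perimeter satisfies P_K[E^{*cyl}] ≤ P_K[E], where E^{*cyl} is the cylindrical rearrangement of E (each transversal section E_{x₁} replaced by an open ball in ℝ^{n-1} centered at 0 with the same (n-1)-dimensional measure). -/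
open MeasureTheory Set Real
open scoped ENNReal

/-- The periodic anisotropic nonlocal perimeter
`P_K[E] = ∫_{E ∩ Ω} ∫_{Eᶜ} K(x - y) dx dy`, with `Ω = {x : -π < x₁ < π}`. -/
noncomputable def perK {m : ℕ} (K : ℝ × EuclideanSpace ℝ (Fin m) → ℝ)
    (E : Set (ℝ × EuclideanSpace ℝ (Fin m))) : ℝ≥0∞ :=
  ∫⁻ x in E ∩ {x : ℝ × EuclideanSpace ℝ (Fin m) | -π < x.1 ∧ x.1 < π},
    ∫⁻ y in Eᶜ, ENNReal.ofReal (K (x - y))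

section Riesz

variable {V : Type*} [NormedAddCommGroup V] [InnerProductSpace ℝ V]

/-- The affine function vanishing on the mirror of `mirror v τ`. -/
noncomputable def mirrorSide (v : V) (τ : ℝ) (x : V) : ℝ := τ - 2 * inner ℝ v x / ‖v‖ ^ 2

/-- The reflection across the hyperplane `2 ⟪v, x⟫ = τ ‖v‖ ^ 2`. -/
noncomputable def mirror (v : V) (τ : ℝ) (x : V) : V := x + mirrorSide v τ x • v

theorem mirrorSide_mirror {v : V} (hv : v ≠ 0) (τ : ℝ) (x : V) :
    mirrorSide v τ (mirror v τ x) = -mirrorSide v τ x := by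
  have : ‖v‖ ≠ 0 := norm_ne_zero_iff.2 hv
  simp only [mirror, mirrorSide, inner_add_right, inner_smul_right, real_inner_self_eq_norm_sq]
  field_simp
  ring

theorem mirror_mirror {v : V} (hv : v ≠ 0) (τ : ℝ) (x : V) : mirror v τ (mirror v τ x) = x := by
  rw [mirror, mirrorSide_mirror hv, mirror]
  simp

theorem norm_mirror_sub_mirror {v : V} (hv : v ≠ 0) (τ : ℝ) (x y : V) :
    ‖mirror v τ x - mirror v τ y‖ = ‖x - y‖ := by
  have hv' : ‖v‖ ≠ 0 := norm_ne_zero_iff.2 hv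
  have key : mirror v τ x - mirror v τ y
      = (x - y) + (-(2 * inner ℝ v (x - y) / ‖v‖ ^ 2)) • v := by
    simp only [mirror, mirrorSide, inner_sub_right]
    module
  rw [← sq_eq_sq₀ (norm_nonneg _) (norm_nonneg _), key, norm_add_sq_real, inner_smul_right,
    norm_smul, mul_pow, real_inner_comm, Real.norm_eq_abs, sq_abs]
  field_simp
  ring

theorem norm_sub_mirror_sq {v : V} (hv : v ≠ 0) (τ : ℝ) (x y : V) :
    ‖x - mirror v τ y‖ ^ 2
      = ‖x - y‖ ^ 2 + ‖v‖ ^ 2 * (mirrorSide v τ x * mirrorSide v τ y) := by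
  have hv' : ‖v‖ ≠ 0 := norm_ne_zero_iff.2 hv
  have key : x - mirror v τ y = (x - y) + (-mirrorSide v τ y) • v := by
    simp only [mirror]
    module
  have hx : mirrorSide v τ x = mirrorSide v τ y - 2 * inner ℝ v (x - y) / ‖v‖ ^ 2 := by
    simp only [mirrorSide, inner_sub_right]
    ring
  rw [key, norm_add_sq_real, inner_smul_right, norm_smul, mul_pow, real_inner_comm,
    Real.norm_eq_abs, sq_abs, hx]
  field_simp
  ring

variable [FiniteDimensional ℝ V] [MeasurableSpace V] [BorelSpace V]

/-- A measure-preserving reflection `σ` across the hyperplane `h = 0`,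
with the origin in the half-space `0 ≤ h`. -/
structure IsFold (σ : V → V) (h : V → ℝ) : Prop where
  measurePreserving : MeasurePreserving σ volume volume
  involutive : ∀ x, σ (σ x) = x
  measurable_side : Measurable h
  side_apply : ∀ x, h (σ x) = -h x
  norm_sub : ∀ x y, ‖σ x - σ y‖ = ‖x - y‖
  norm_sub_le : ∀ x y, 0 ≤ h x * h y → ‖x - y‖ ≤ ‖x - σ y‖
  side_zero : 0 ≤ h 0

theorem measurable_mirrorSide (v : V) (τ : ℝ) : Measurable (mirrorSide v τ) := by
  unfold mirrorSide
  fun_prop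

theorem measurePreserving_mirror (v : V) (τ : ℝ) :
    MeasurePreserving (mirror v τ) volume volume := by
  have h := (measurePreserving_add_right (volume : Measure V) (τ • v)).comp
    ((ℝ ∙ v)ᗮ.reflection).measurePreserving
  have e : mirror v τ = (fun x => x + τ • v) ∘ (ℝ ∙ v)ᗮ.reflection := by
    funext x
    simp only [mirror, mirrorSide, Function.comp, Submodule.reflection_orthogonal_apply,
      Submodule.reflection_singleton_apply, RCLike.ofReal_real_eq_id, id]
    module
  rwa [e]

theorem exists_isFold_mirror {v : V} (hv : v ≠ 0) (τ : ℝ) : ∃ h, IsFold (mirror v τ) h := by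
  have hle : ∀ x y, 0 ≤ mirrorSide v τ x * mirrorSide v τ y → ‖x - y‖ ≤ ‖x - mirror v τ y‖ := by
    intro x y hxy
    rw [← sq_le_sq₀ (norm_nonneg _) (norm_nonneg _), norm_sub_mirror_sq hv]
    have := mul_nonneg (sq_nonneg ‖v‖) hxy
    linarith
  rcases le_total 0 τ with hτ | hτ
  · exact ⟨mirrorSide v τ, measurePreserving_mirror v τ, mirror_mirror hv τ,
      measurable_mirrorSide v τ, mirrorSide_mirror hv τ, norm_mirror_sub_mirror hv τ, hle,
      by simpa [mirrorSide] using hτ⟩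
  · exact ⟨fun x => -mirrorSide v τ x, measurePreserving_mirror v τ, mirror_mirror hv τ,
      (measurable_mirrorSide v τ).neg, fun x => by rw [mirrorSide_mirror hv τ],
      norm_mirror_sub_mirror hv τ, fun x y hxy => hle x y (by simpa using hxy),
      by simpa [mirrorSide] using hτ⟩

/-- The polarization (two-point rearrangement) of `A`: on each pair `{x, σ x}` the part of `A` is
moved to the side `0 ≤ h`. -/
def polarization (σ : V → V) (h : V → ℝ) (A : Set V) : Set V :=
  {x | 0 ≤ h x ∧ (x ∈ A ∨ σ x ∈ A) ∨ h x < 0 ∧ x ∈ A ∧ σ x ∈ A}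

/-- The Riesz functional `∫_A ∫_B k(x - y) dy dx`. -/
noncomputable def rieszFunctional (k : V → ℝ≥0∞) (A B : Set V) : ℝ≥0∞ :=
  ∫⁻ x in A, ∫⁻ y in B, k (x - y)

theorem rieszFunctional_eq_lintegral_prod {k : V → ℝ≥0∞} (hk : Measurable k) {A B : Set V}
    (hA : MeasurableSet A) (hB : MeasurableSet B) :
    rieszFunctional k A B = ∫⁻ p : V × V,
      A.indicator 1 p.1 * B.indicator 1 p.2 * k (p.1 - p.2) ∂(volume.prod volume) := by
  have hm : Measurable fun p : V × V =>
      A.indicator (1 : V → ℝ≥0∞) p.1 * B.indicator 1 p.2 * k (p.1 - p.2) :=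
    (((measurable_one.indicator hA).comp measurable_fst).mul
      ((measurable_one.indicator hB).comp measurable_snd)).mul
      (hk.comp (measurable_fst.sub measurable_snd))
  rw [lintegral_prod _ hm.aemeasurable, rieszFunctional, ← lintegral_indicator hA]
  refine lintegral_congr fun x => ?_
  by_cases hx : x ∈ A
  · simp only [hx, indicator_of_mem, Pi.one_apply, one_mul]
    rw [← lintegral_indicator hB]
    refine lintegral_congr fun y => ?_
    by_cases hy : y ∈ B <;> simp [hy]
  · simp [hx]

theorem two_point_rearrangement {a b : ℝ≥0∞} (hba : b ≤ a) (p p' q q' : Prop)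
    [Decidable p] [Decidable p'] [Decidable q] [Decidable q'] :
    ((if p then 1 else 0) * (if q then 1 else 0) * a
      + (if p then 1 else 0) * (if q' then 1 else 0) * b
      + (if p' then 1 else 0) * (if q then 1 else 0) * b
      + (if p' then 1 else 0) * (if q' then 1 else 0) * a)
    ≤ ((if p ∨ p' then 1 else 0) * (if q ∨ q' then 1 else 0) * a
      + (if p ∨ p' then 1 else 0) * (if q ∧ q' then 1 else 0) * b
      + (if p ∧ p' then 1 else 0) * (if q ∨ q' then 1 else 0) * b
      + (if p ∧ p' then 1 else 0) * (if q ∧ q' then 1 else 0) * a) := by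
  by_cases hp : p <;> by_cases hp' : p' <;> by_cases hq : q <;> by_cases hq' : q' <;>
    simp [hp, hp', hq, hq', hba, add_comm]

namespace IsFold

variable {σ : V → V} {h : V → ℝ} {A B : Set V}

theorem apply_eq_self (H : IsFold σ h) {x : V} (hx : h x = 0) : σ x = x := by
  have := H.norm_sub_le (σ x) x (by simp [hx])
  simpa [sub_eq_zero] using this

theorem mem_polarization_iff (H : IsFold σ h) {x : V} (hx : 0 ≤ h x) :
    (x ∈ polarization σ h A ↔ x ∈ A ∨ σ x ∈ A) ∧
      (σ x ∈ polarization σ h A ↔ x ∈ A ∧ σ x ∈ A) := by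
  simp only [polarization, mem_ofPred_eq, H.side_apply, H.involutive]
  rcases hx.eq_or_lt with h0 | h0
  · simp [← h0, H.apply_eq_self h0.symm]
  · constructor
    · simp [hx, not_lt.2 hx]
    · simp [h0, not_le.2 h0]
      tauto

theorem measurableSet_polarization (H : IsFold σ h) (hA : MeasurableSet A) :
    MeasurableSet (polarization σ h A) := by
  have hσ : MeasurableSet (σ ⁻¹' A) := H.measurePreserving.measurable hA
  exact ((measurableSet_le measurable_const H.measurable_side).inter (hA.union hσ)).union
    ((measurableSet_lt H.measurable_side measurable_const).inter (hA.inter hσ))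

theorem norm_le_norm_apply (H : IsFold σ h) {x : V} (hx : 0 ≤ h x) : ‖x‖ ≤ ‖σ x‖ := by
  simpa using H.norm_sub_le 0 x (mul_nonneg H.side_zero hx)

theorem lintegral_add_comp (H : IsFold σ h) {f : V → ℝ≥0∞} (hf : Measurable f) :
    ∫⁻ x, (f x + f (σ x)) = 2 * ∫⁻ x, f x := by
  rw [lintegral_add_left hf, H.measurePreserving.lintegral_comp hf, two_mul]

theorem volume_polarization (H : IsFold σ h) (hA : MeasurableSet A) :
    volume (polarization σ h A) = volume A := by
  have hP := H.measurableSet_polarization hA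
  have h2 : 2 * volume (polarization σ h A) = 2 * volume A := by
    rw [← lintegral_indicator_one hP, ← lintegral_indicator_one hA,
      ← H.lintegral_add_comp (measurable_one.indicator hP),
      ← H.lintegral_add_comp (measurable_one.indicator hA)]
    have key : ∀ x, 0 ≤ h x → (polarization σ h A).indicator (1 : V → ℝ≥0∞) x
        + (polarization σ h A).indicator 1 (σ x) = A.indicator 1 x + A.indicator 1 (σ x) := by
      intro x hx
      obtain ⟨h1, h2⟩ := H.mem_polarization_iff (A := A) hx
      by_cases ha : x ∈ A <;> by_cases hb : σ x ∈ A <;> simp [h1, h2, ha, hb]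
    refine lintegral_congr fun x => ?_
    rcases le_total 0 (h x) with hx | hx
    · exact key x hx
    · have := key (σ x) (by rw [H.side_apply]; linarith)
      rwa [H.involutive, add_comm, add_comm (A.indicator _ _)] at this
  exact (ENNReal.mul_right_inj (by simp) (by simp)).1 h2

theorem volume_polarization_diff_ball_add_le (H : IsFold σ h) (hA : MeasurableSet A) (r : ℝ) :
    volume (polarization σ h A \ Metric.ball 0 r)
      + volume ((A \ Metric.ball 0 r) ∩ σ ⁻¹' (Metric.ball 0 r \ A))
      ≤ volume (A \ Metric.ball 0 r) := by
  set S : Set V := Metric.ball 0 r with hS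
  have hSm : MeasurableSet S := Metric.isOpen_ball.measurableSet
  have hP := (H.measurableSet_polarization hA).diff hSm
  have hW : MeasurableSet ((A \ S) ∩ σ ⁻¹' (S \ A)) :=
    (hA.diff hSm).inter (H.measurePreserving.measurable (hSm.diff hA))
  have hAS := hA.diff hSm
  refine (ENNReal.mul_le_mul_iff_right (a := 2) (by simp) (by simp)).1 ?_
  rw [mul_add, ← lintegral_indicator_one hP, ← lintegral_indicator_one hW,
    ← lintegral_indicator_one hAS, ← H.lintegral_add_comp (measurable_one.indicator hP),
    ← H.lintegral_add_comp (measurable_one.indicator hW),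
    ← H.lintegral_add_comp (measurable_one.indicator hAS), ← lintegral_add_left]
  swap
  · exact (measurable_one.indicator hP).add
      ((measurable_one.indicator hP).comp H.measurePreserving.measurable)
  have key : ∀ x, 0 ≤ h x →
      ((polarization σ h A \ S).indicator (1 : V → ℝ≥0∞) x
        + (polarization σ h A \ S).indicator 1 (σ x))
      + (((A \ S) ∩ σ ⁻¹' (S \ A)).indicator 1 x + ((A \ S) ∩ σ ⁻¹' (S \ A)).indicator 1 (σ x))
      ≤ (A \ S).indicator 1 x + (A \ S).indicator 1 (σ x) := by
    intro x hx
    obtain ⟨h1, h2⟩ := H.mem_polarization_iff (A := A) hx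
    have h3 : σ x ∈ S → x ∈ S := by
      simp only [hS, mem_ball_zero_iff]
      exact (H.norm_le_norm_apply hx).trans_lt
    by_cases ha : x ∈ A <;> by_cases hb : σ x ∈ A <;> by_cases hc : x ∈ S <;>
      by_cases hd : σ x ∈ S <;>
      first
      | exact absurd (h3 hd) hc
      | simp [h1, h2, ha, hb, hc, hd, H.involutive]
  refine lintegral_mono fun x => ?_
  rcases le_total 0 (h x) with hx | hx
  · exact key x hx
  · have := key (σ x) (by rw [H.side_apply]; linarith)
    rw [H.involutive] at this
    convert this using 1
    · ring
    · ring

theorem rieszFunctional_le_polarization (H : IsFold σ h) {k : V → ℝ≥0∞} (hk : Measurable k)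
    (hdec : ∀ x y, ‖x‖ ≤ ‖y‖ → k y ≤ k x) (hA : MeasurableSet A) (hB : MeasurableSet B) :
    rieszFunctional k A B
      ≤ rieszFunctional k (polarization σ h A) (polarization σ h B) := by
  classical
  have hσ := H.measurePreserving
  have four : ∀ {A B : Set V}, MeasurableSet A → MeasurableSet B →
      4 * rieszFunctional k A B = ∫⁻ p : V × V,
        (A.indicator 1 p.1 * B.indicator 1 p.2 * k (p.1 - p.2)
        + A.indicator 1 p.1 * B.indicator 1 (σ p.2) * k (p.1 - σ p.2)
        + A.indicator 1 (σ p.1) * B.indicator 1 p.2 * k (σ p.1 - p.2)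
        + A.indicator 1 (σ p.1) * B.indicator 1 (σ p.2) * k (σ p.1 - σ p.2))
        ∂(volume.prod volume) := by
    intro A B hA hB
    set F : V × V → ℝ≥0∞ := fun p =>
      A.indicator (1 : V → ℝ≥0∞) p.1 * B.indicator 1 p.2 * k (p.1 - p.2) with hF
    have hm : Measurable F :=
      (((measurable_one.indicator hA).comp measurable_fst).mul
        ((measurable_one.indicator hB).comp measurable_snd)).mul
        (hk.comp (measurable_fst.sub measurable_snd))
    have h1 := (MeasurePreserving.id (volume : Measure V)).prod hσ
    have h2 := hσ.prod (MeasurePreserving.id (volume : Measure V))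
    have h3 := hσ.prod hσ
    have e1 := h1.lintegral_comp hm
    have e2 := h2.lintegral_comp hm
    have e3 := h3.lintegral_comp hm
    have m1 : Measurable fun p => F (Prod.map id σ p) := hm.comp h1.measurable
    have m2 : Measurable fun p => F (Prod.map σ id p) := hm.comp h2.measurable
    have m3 : Measurable fun p => F (Prod.map σ σ p) := hm.comp h3.measurable
    have : ∫⁻ p, (F p + F (Prod.map id σ p) + F (Prod.map σ id p) + F (Prod.map σ σ p))
        ∂(volume.prod volume) = 4 * ∫⁻ p, F p ∂(volume.prod volume) := by
      rw [lintegral_add_right _ m3, lintegral_add_right _ m2,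
        lintegral_add_right _ m1, e1, e2, e3]
      ring
    rw [rieszFunctional_eq_lintegral_prod hk hA hB, ← this]
    rfl
  refine (ENNReal.mul_le_mul_iff_right (a := 4) (by simp) (by simp)).1 ?_
  rw [four hA hB, four (H.measurableSet_polarization hA) (H.measurableSet_polarization hB)]
  set A' := polarization σ h A
  set B' := polarization σ h B
  have keq : ∀ x y, k (σ x - σ y) = k (x - y) := fun x y =>
    le_antisymm (hdec _ _ (H.norm_sub x y).ge) (hdec _ _ (H.norm_sub x y).le)
  have key : ∀ x y, 0 ≤ h x → 0 ≤ h y →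
      A.indicator 1 x * B.indicator 1 y * k (x - y)
        + A.indicator 1 x * B.indicator 1 (σ y) * k (x - σ y)
        + A.indicator 1 (σ x) * B.indicator 1 y * k (σ x - y)
        + A.indicator 1 (σ x) * B.indicator 1 (σ y) * k (σ x - σ y)
      ≤ A'.indicator 1 x * B'.indicator 1 y * k (x - y)
        + A'.indicator 1 x * B'.indicator 1 (σ y) * k (x - σ y)
        + A'.indicator 1 (σ x) * B'.indicator 1 y * k (σ x - y)
        + A'.indicator 1 (σ x) * B'.indicator 1 (σ y) * k (σ x - σ y) := by
    intro x y hx hy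
    obtain ⟨a1, a2⟩ := H.mem_polarization_iff (A := A) hx
    obtain ⟨b1, b2⟩ := H.mem_polarization_iff (A := B) hy
    have e1 : k (σ x - y) = k (x - σ y) := by
      conv_lhs => rw [← H.involutive y]
      exact keq _ _
    simp only [indicator_apply, A', B', a1, a2, b1, b2, keq, e1, Pi.one_apply]
    exact two_point_rearrangement (hdec _ _ (H.norm_sub_le x y (mul_nonneg hx hy))) _ _ _ _
  refine lintegral_mono fun p => ?_
  obtain ⟨x, y⟩ := p
  have hs : ∀ z, h z ≤ 0 → 0 ≤ h (σ z) := fun z hz => by rw [H.side_apply]; linarith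
  rcases le_total 0 (h x) with hx | hx <;> rcases le_total 0 (h y) with hy | hy
  · exact key x y hx hy
  · have := key x (σ y) hx (hs y hy)
    rw [H.involutive] at this
    convert this using 1 <;> ring
  · have := key (σ x) y (hs x hx) hy
    rw [H.involutive] at this
    convert this using 1 <;> ring
  · have := key (σ x) (σ y) (hs x hx) (hs y hy)
    rw [H.involutive, H.involutive] at this
    convert this using 1 <;> ring

end IsFold

open scoped Pointwise in
theorem le_volume_setOf_add_smul_mem {x : V} {U : Set V} {R ρ s : ℝ} {δ : ℝ≥0∞}
    (hUR : U ⊆ Metric.closedBall 0 R) (hx : x ∈ Metric.closedBall (0 : V) R)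
    (hρ : volume (Metric.closedBall (0 : V) (2 * ρ)) ≤ δ / 2) (hρ0 : 0 < ρ) (hδ : δ ≠ ⊤)
    (hU : δ ≤ volume U) (hs : s ∈ Icc (1 : ℝ) 2) :
    ENNReal.ofReal ((1 / 2) ^ Module.finrank ℝ V) * (δ / 2)
      ≤ volume ({v : V | ρ ≤ ‖v‖ ∧ ‖v‖ ≤ 2 * R} ∩ {v | x + s • v ∈ U}) := by
  obtain ⟨hs1, hs2⟩ := hs
  have hs0 : 0 < s := by linarith
  have hsub : s⁻¹ • (((fun z => z + x) ⁻¹' U) \ Metric.closedBall 0 (2 * ρ))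
      ⊆ {v : V | ρ ≤ ‖v‖ ∧ ‖v‖ ≤ 2 * R} ∩ {v | x + s • v ∈ U} := by
    rintro _ ⟨u, ⟨hu, hu'⟩, rfl⟩
    have hu1 : u + x ∈ U := hu
    have hn := hUR hu1
    rw [mem_closedBall_zero_iff] at hn hx hu'
    have hu2 : ‖u‖ ≤ 2 * R := by
      have := norm_sub_le (u + x) x
      rw [add_sub_cancel_right] at this
      linarith
    refine ⟨⟨?_, ?_⟩, ?_⟩
    · simp only [norm_smul, norm_inv, Real.norm_eq_abs, abs_of_pos hs0]
      rw [← div_eq_inv_mul, le_div_iff₀ hs0]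
      nlinarith
    · simp only [norm_smul, norm_inv, Real.norm_eq_abs, abs_of_pos hs0]
      rw [← div_eq_inv_mul]
      exact (div_le_self (norm_nonneg _) hs1).trans hu2
    · simpa [smul_smul, hs0.ne', add_comm] using hu1
  refine le_trans ?_ (measure_mono hsub)
  rw [Measure.addHaar_smul]
  refine mul_le_mul' (ENNReal.ofReal_le_ofReal ?_) ?_
  · rw [abs_of_pos (by positivity)]
    gcongr
    rw [one_div]
    gcongr
  · refine le_trans ?_ le_measure_sdiff
    rw [measure_preimage_add_right]
    calc δ / 2 = δ - δ / 2 := (ENNReal.sub_half hδ).symm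
      _ ≤ _ := tsub_le_tsub hU hρ

theorem exists_closedBall_volume_le [Nontrivial V] {δ : ℝ≥0∞} (hδ0 : δ ≠ 0) :
    ∃ ρ : ℝ, 0 < ρ ∧ volume (Metric.closedBall (0 : V) ρ) ≤ δ := by
  have ht : Filter.Tendsto (fun n : ℕ => volume (Metric.closedBall (0 : V) (1 / ((n : ℝ) + 1))))
      Filter.atTop (nhds (volume ({0} : Set V))) := by
    have hi : ⋂ n : ℕ, Metric.closedBall (0 : V) (1 / ((n : ℝ) + 1)) = {0} := by
      ext x
      simp only [mem_iInter, mem_closedBall_zero_iff, mem_singleton_iff]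
      refine ⟨fun hx => ?_, fun hx n => by simp only [hx, norm_zero]; positivity⟩
      exact norm_le_zero_iff.1 (ge_of_tendsto' tendsto_one_div_add_atTop_nhds_zero_nat hx)
    rw [← hi]
    refine tendsto_measure_iInter_atTop (fun n => Metric.isClosed_closedBall.nullMeasurableSet)
      (fun m n hmn => Metric.closedBall_subset_closedBall ?_)
      ⟨0, measure_closedBall_lt_top.ne⟩
    gcongr
  rw [measure_singleton] at ht
  obtain ⟨n, hn⟩ := (ht.eventually (gt_mem_nhds (pos_iff_ne_zero.2 hδ0))).exists
  exact ⟨_, by positivity, hn.le⟩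

theorem le_lintegral_indicator_mirror {x : V} {U : Set V} {R ρ : ℝ} {δ : ℝ≥0∞}
    (hUm : MeasurableSet U)
    (hUR : U ⊆ Metric.closedBall 0 R) (hx : x ∈ Metric.closedBall (0 : V) R)
    (hρ : volume (Metric.closedBall (0 : V) (2 * ρ)) ≤ δ / 2) (hρ0 : 0 < ρ) (hδ : δ ≠ ⊤)
    (hU : δ ≤ volume U) :
    ENNReal.ofReal ((1 / 2) ^ Module.finrank ℝ V) * (δ / 2)
      ≤ ∫⁻ v in {v : V | ρ ≤ ‖v‖ ∧ ‖v‖ ≤ 2 * R},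
        ∫⁻ τ in Icc (-(2 + 2 * R / ρ)) (2 + 2 * R / ρ), U.indicator 1 (mirror v τ x) := by
  set S : Set V := {v : V | ρ ≤ ‖v‖ ∧ ‖v‖ ≤ 2 * R} with hS
  have hSm : MeasurableSet S :=
    (measurableSet_le measurable_const measurable_norm).inter
      (measurableSet_le measurable_norm measurable_const)
  have hmeas : Measurable fun p : V × ℝ => U.indicator (1 : V → ℝ≥0∞) (x + p.2 • p.1) :=
    (measurable_one.indicator hUm).comp (by fun_prop)
  calc ENNReal.ofReal ((1 / 2) ^ Module.finrank ℝ V) * (δ / 2)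
      = ∫⁻ s in Icc (1 : ℝ) 2, ENNReal.ofReal ((1 / 2) ^ Module.finrank ℝ V) * (δ / 2) := by
        rw [setLIntegral_const, Real.volume_Icc]
        norm_num
    _ ≤ ∫⁻ s in Icc (1 : ℝ) 2, ∫⁻ v in S, U.indicator 1 (x + s • v) := by
        refine setLIntegral_mono' measurableSet_Icc fun s hs => ?_
        refine (le_volume_setOf_add_smul_mem hUR hx hρ hρ0 hδ hU hs).trans ?_
        have hm : MeasurableSet {v : V | x + s • v ∈ U} :=
          (by fun_prop : Measurable fun v : V => x + s • v) hUm
        rw [← lintegral_indicator hSm, ← lintegral_indicator_one (hSm.inter hm)]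
        refine lintegral_mono fun v => ?_
        by_cases h1 : v ∈ S <;> by_cases h2 : x + s • v ∈ U <;> simp [h1, h2]
    _ = ∫⁻ v in S, ∫⁻ s in Icc (1 : ℝ) 2, U.indicator 1 (x + s • v) :=
        (lintegral_lintegral_swap hmeas.aemeasurable).symm
    _ ≤ _ := by
        refine setLIntegral_mono' hSm fun v hv => ?_
        rw [← lintegral_indicator measurableSet_Icc, ← lintegral_indicator measurableSet_Icc]
        rw [← lintegral_sub_right_eq_self (μ := (volume : Measure ℝ)) _
          (2 * inner ℝ v x / ‖v‖ ^ 2)]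
        refine lintegral_mono fun τ => ?_
        by_cases hτ : τ - 2 * inner ℝ v x / ‖v‖ ^ 2 ∈ Icc (1 : ℝ) 2
        · have hτ' : τ ∈ Icc (-(2 + 2 * R / ρ)) (2 + 2 * R / ρ) := by
            have hvpos : 0 < ‖v‖ := hρ0.trans_le hv.1
            have hR : 0 ≤ R := by have := hv.2; linarith
            have : |2 * inner ℝ v x / ‖v‖ ^ 2| ≤ 2 * R / ρ := by
              rw [abs_div, abs_mul, abs_of_pos (two_pos : (0 : ℝ) < 2),
                abs_of_pos (pow_pos hvpos 2), div_le_div_iff₀ (by positivity) hρ0]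
              have h1 := abs_real_inner_le_norm v x
              rw [mem_closedBall_zero_iff] at hx
              calc 2 * |inner ℝ v x| * ρ ≤ 2 * (‖v‖ * ‖x‖) * ρ := by gcongr
                _ ≤ 2 * (‖v‖ * R) * ‖v‖ := by gcongr; exact hv.1
                _ = 2 * R * ‖v‖ ^ 2 := by ring
            rw [abs_le] at this
            obtain ⟨t1, t2⟩ := hτ
            constructor <;> linarith
          rw [indicator_of_mem hτ, indicator_of_mem hτ']
          rfl
        · rw [indicator_of_notMem hτ]
          exact zero_le

/-- Two sets of measure at least `δ` in a fixed ball overlap, after a suitable reflection, in a set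
whose measure is bounded below in terms of `δ` and the ball only. -/
theorem exists_mirror_overlap [Nontrivial V] (R : ℝ) {δ : ℝ≥0∞} (hδ0 : δ ≠ 0) (hδ : δ ≠ ⊤) :
    ∃ ε : ℝ≥0∞, ε ≠ 0 ∧ ∀ U W : Set V, MeasurableSet U → MeasurableSet W →
      U ⊆ Metric.closedBall 0 R → W ⊆ Metric.closedBall 0 R → δ ≤ volume U → δ ≤ volume W →
      ∃ (v : V) (τ : ℝ), v ≠ 0 ∧ ε ≤ volume (W ∩ mirror v τ ⁻¹' U) := by
  obtain ⟨ρ', hρ'0, hρ'⟩ := exists_closedBall_volume_le (V := V) (δ := δ / 2)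
    (ENNReal.half_pos hδ0).ne'
  obtain ⟨ρ, rfl⟩ : ∃ ρ, ρ' = 2 * ρ := ⟨ρ' / 2, by ring⟩
  have hρ0 : 0 < ρ := by linarith
  set S : Set V := {v : V | ρ ≤ ‖v‖ ∧ ‖v‖ ≤ 2 * R} with hS
  have hSm : MeasurableSet S :=
    (measurableSet_le measurable_const measurable_norm).inter
      (measurableSet_le measurable_norm measurable_const)
  have hSfin : volume S < ⊤ := by
    refine lt_of_le_of_lt (measure_mono ?_)
      (measure_closedBall_lt_top (x := (0 : V)) (r := 2 * R))
    intro v hv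
    simpa using hv.2
  set T : ℝ := 2 + 2 * R / ρ with hT
  set M : ℝ≥0∞ := volume (Icc (-T) T) * volume S with hM
  have hMfin : M ≠ ⊤ := ENNReal.mul_ne_top measure_Icc_lt_top.ne hSfin.ne
  set c : ℝ≥0∞ := ENNReal.ofReal ((1 / 2) ^ Module.finrank ℝ V) * (δ / 2) with hc
  have hc0 : c ≠ 0 := mul_ne_zero (by simp) (ENNReal.half_pos hδ0).ne'
  have hcfin : c ≠ ⊤ := ENNReal.mul_ne_top (by simp) (ENNReal.div_ne_top hδ (by simp))
  refine ⟨δ * c / (M + 1), ?_, ?_⟩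
  · exact (ENNReal.div_pos (mul_ne_zero hδ0 hc0) (by simp [hMfin])).ne'
  intro U W hUm hWm hUR hWR hU hW
  by_contra! hcon
  have hε : δ * c / (M + 1) * M < δ * c := by
    have hlt : M < M + 1 := ENNReal.lt_add_right hMfin one_ne_zero
    calc δ * c / (M + 1) * M < δ * c / (M + 1) * (M + 1) :=
          (ENNReal.mul_lt_mul_iff_right
            (ENNReal.div_pos (mul_ne_zero hδ0 hc0) (by simp [hMfin])).ne'
            (ENNReal.div_ne_top (ENNReal.mul_ne_top hδ hcfin) (by simp))).2 hlt
      _ = δ * c := ENNReal.div_mul_cancel (by simp) (by simp [hMfin])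
  have hmir : Measurable fun p : V × V × ℝ => mirror p.2.1 p.2.2 p.1 := by
    unfold mirror mirrorSide
    fun_prop
  have hF : Measurable fun p : V × V × ℝ => U.indicator (1 : V → ℝ≥0∞) (mirror p.2.1 p.2.2 p.1) :=
    (measurable_one.indicator hUm).comp hmir
  have lower : δ * c ≤ ∫⁻ x in W, ∫⁻ v in S, ∫⁻ τ in Icc (-T) T, U.indicator 1 (mirror v τ x) := by
    calc δ * c ≤ volume W * c := by gcongr
      _ = ∫⁻ x in W, c := by rw [setLIntegral_const, mul_comm]
      _ ≤ _ := setLIntegral_mono' hWm fun x hx =>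
        le_lintegral_indicator_mirror hUm hUR (hWR hx) hρ' hρ0 hδ hU
  have swap : ∫⁻ x in W, ∫⁻ v in S, ∫⁻ τ in Icc (-T) T, U.indicator 1 (mirror v τ x)
      = ∫⁻ v in S, ∫⁻ τ in Icc (-T) T, volume (W ∩ mirror v τ ⁻¹' U) := by
    rw [lintegral_lintegral_swap]
    · refine lintegral_congr fun v => ?_
      rw [lintegral_lintegral_swap]
      · refine lintegral_congr fun τ => ?_
        have hm : Measurable (mirror v τ) := by
          unfold mirror mirrorSide
          fun_prop
        have : ∀ x, U.indicator (1 : V → ℝ≥0∞) (mirror v τ x)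
            = (mirror v τ ⁻¹' U).indicator 1 x := fun x => rfl
        simp only [this]
        rw [lintegral_indicator_one (hm hUm), Measure.restrict_apply (hm hUm), inter_comm]
      · exact (hF.comp (by fun_prop : Measurable fun q : V × ℝ => (q.1, v, q.2))).aemeasurable
    · refine Measurable.aemeasurable ?_
      have : Measurable fun q : (V × V) × ℝ =>
          U.indicator (1 : V → ℝ≥0∞) (mirror q.1.2 q.2 q.1.1) :=
        hF.comp (by fun_prop : Measurable fun q : (V × V) × ℝ => (q.1.1, q.1.2, q.2))
      exact this.lintegral_prod_right'
  have upper : ∫⁻ v in S, ∫⁻ τ in Icc (-T) T, volume (W ∩ mirror v τ ⁻¹' U)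
      ≤ δ * c / (M + 1) * M := by
    calc _ ≤ ∫⁻ v in S, ∫⁻ τ in Icc (-T) T, δ * c / (M + 1) :=
          setLIntegral_mono' hSm fun v hv => lintegral_mono fun τ =>
            (hcon v τ (norm_pos_iff.1 (hρ0.trans_le hv.1))).le
      _ = _ := by rw [setLIntegral_const, setLIntegral_const, hM, mul_assoc]
  exact absurd (lower.trans (swap.le.trans upper)) (not_le.2 hε)

theorem measurable_setLIntegral_sub {k : V → ℝ≥0∞} (hk : Measurable k) (B : Set V) :
    Measurable fun x => ∫⁻ y in B, k (x - y) :=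
  (hk.comp (measurable_fst.sub measurable_snd)).lintegral_prod_right'
    (f := fun p : V × V => k (p.1 - p.2))

theorem rieszFunctional_le_left {k : V → ℝ≥0∞} (A B : Set V) :
    rieszFunctional k A B ≤ (∫⁻ z, k z) * volume A := by
  calc rieszFunctional k A B ≤ ∫⁻ _ in A, ∫⁻ z, k z :=
        lintegral_mono fun x => (setLIntegral_le_lintegral _ _).trans
          (lintegral_sub_left_eq_self k x).le
    _ = _ := setLIntegral_const _ _

theorem rieszFunctional_le_right {k : V → ℝ≥0∞} (hk : Measurable k) (A B : Set V) :
    rieszFunctional k A B ≤ (∫⁻ z, k z) * volume B := by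
  have hm : Measurable (Function.uncurry fun x y : V => k (x - y)) :=
    hk.comp (measurable_fst.sub measurable_snd)
  rw [rieszFunctional, lintegral_lintegral_swap hm.aemeasurable]
  calc ∫⁻ y in B, ∫⁻ x in A, k (x - y) ≤ ∫⁻ _ in B, ∫⁻ z, k z :=
        lintegral_mono fun y => (setLIntegral_le_lintegral _ _).trans
          (lintegral_sub_right_eq_self k y).le
    _ = _ := setLIntegral_const _ _

theorem rieszFunctional_le_add {k : V → ℝ≥0∞} (hk : Measurable k) (A B A' B' : Set V) :
    rieszFunctional k A B ≤ rieszFunctional k A' B'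
      + (∫⁻ z, k z) * (volume (A \ A') + volume (B \ B')) := by
  have h1 : rieszFunctional k A B ≤ rieszFunctional k A' B + rieszFunctional k (A \ A') B :=
    (lintegral_mono_set (by simp)).trans (lintegral_union_le _ A' (A \ A'))
  have h2 : rieszFunctional k A' B ≤ rieszFunctional k A' B' + rieszFunctional k A' (B \ B') := by
    unfold rieszFunctional
    rw [← lintegral_add_left (measurable_setLIntegral_sub hk _)]
    exact lintegral_mono fun x =>
      (lintegral_mono_set (by simp)).trans (lintegral_union_le _ B' (B \ B'))
  calc rieszFunctional k A B
      ≤ (rieszFunctional k A' B' + rieszFunctional k A' (B \ B'))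
        + rieszFunctional k (A \ A') B := h1.trans (by gcongr)
    _ ≤ (rieszFunctional k A' B' + (∫⁻ z, k z) * volume (B \ B'))
        + (∫⁻ z, k z) * volume (A \ A') := by
        gcongr
        · exact rieszFunctional_le_right hk _ _
        · exact rieszFunctional_le_left _ _
    _ = _ := by ring

theorem exists_volume_diff_ball_le {A : Set V} (hA : MeasurableSet A) (hfin : volume A ≠ ⊤)
    {δ : ℝ≥0∞} (hδ : δ ≠ 0) : ∃ R₀ : ℝ, ∀ R, R₀ ≤ R → volume (A \ Metric.ball 0 R) ≤ δ := by
  have ht : Filter.Tendsto (fun n : ℕ => volume (A \ Metric.ball (0 : V) n))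
      Filter.atTop (nhds (volume (∅ : Set V))) := by
    have hi : ⋂ n : ℕ, A \ Metric.ball (0 : V) n = ∅ := by
      refine eq_empty_of_forall_notMem fun x hx => ?_
      obtain ⟨n, hn⟩ := exists_nat_gt ‖x‖
      exact (mem_iInter.1 hx n).2 (mem_ball_zero_iff.2 hn)
    rw [← hi]
    refine tendsto_measure_iInter_atTop
      (fun n => (hA.diff Metric.isOpen_ball.measurableSet).nullMeasurableSet)
      (fun m n hmn => sdiff_subset_sdiff_right (Metric.ball_subset_ball (by exact_mod_cast hmn)))
      ⟨0, measure_ne_top_of_subset sdiff_subset hfin⟩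
  rw [measure_empty] at ht
  obtain ⟨n, hn⟩ := (ht.eventually (gt_mem_nhds (pos_iff_ne_zero.2 hδ))).exists
  exact ⟨n, fun R hR =>
    (measure_mono (sdiff_subset_sdiff_right (Metric.ball_subset_ball hR))).trans hn.le⟩

theorem nontrivial_of_volume_diff_ball_ne_zero {A : Set V} {r : ℝ} (hA : MeasurableSet A)
    (hr : volume (Metric.ball (0 : V) r) = volume A) (h : volume (A \ Metric.ball 0 r) ≠ 0) :
    Nontrivial V := by
  have hb : volume (Metric.ball (0 : V) r) ≠ ⊤ := measure_ball_lt_top.ne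
  have heq := measure_sdiff_symm hA.nullMeasurableSet
    (Metric.isOpen_ball (x := (0 : V)) (ε := r)).measurableSet.nullMeasurableSet hr.symm
    (measure_ne_top_of_subset inter_subset_right hb)
  obtain ⟨x, hx⟩ := nonempty_of_measure_ne_zero h
  obtain ⟨y, hy⟩ := nonempty_of_measure_ne_zero (heq ▸ h)
  exact ⟨x, y, fun hxy => hx.2 (hxy ▸ hy.1)⟩

theorem exists_isFold_volume_diff_ball_add_le {A : Set V} {r R : ℝ} {δ ε : ℝ≥0∞}
    (hA : MeasurableSet A) (hr : volume (Metric.ball (0 : V) r) = volume A) (hrR : r ≤ R)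
    (hδ : δ ≠ ⊤) (hAr : 2 * δ ≤ volume (A \ Metric.ball 0 r))
    (hAR : volume (A \ Metric.ball 0 R) ≤ δ)
    (hε : ∀ U W : Set V, MeasurableSet U → MeasurableSet W →
      U ⊆ Metric.closedBall 0 R → W ⊆ Metric.closedBall 0 R → δ ≤ volume U → δ ≤ volume W →
      ∃ (v : V) (τ : ℝ), v ≠ 0 ∧ ε ≤ volume (W ∩ mirror v τ ⁻¹' U)) :
    ∃ (σ : V → V) (h : V → ℝ), IsFold σ h ∧
      volume (polarization σ h A \ Metric.ball 0 r) + ε ≤ volume (A \ Metric.ball 0 r) := by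
  have hbm : ∀ t : ℝ, MeasurableSet (Metric.ball (0 : V) t) :=
    fun t => Metric.isOpen_ball.measurableSet
  have heq := measure_sdiff_symm hA.nullMeasurableSet (hbm r).nullMeasurableSet hr.symm
    (measure_ne_top_of_subset inter_subset_right measure_ball_lt_top.ne)
  obtain ⟨v, τ, hv, hle⟩ := hε (Metric.ball 0 r \ A) ((A \ Metric.ball 0 r) ∩ Metric.ball 0 R)
    ((hbm r).diff hA) ((hA.diff (hbm r)).inter (hbm R))
    (sdiff_subset.trans ((Metric.ball_subset_ball hrR).trans Metric.ball_subset_closedBall))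
    (inter_subset_right.trans Metric.ball_subset_closedBall)
    (by
      rw [← heq]
      exact le_trans (by rw [two_mul]; exact le_self_add) hAr)
    (by
      have h1 := measure_inter_add_sdiff (μ := volume) (A \ Metric.ball (0 : V) r) (hbm R)
      have h2 : volume ((A \ Metric.ball (0 : V) r) \ Metric.ball 0 R) ≤ δ :=
        (measure_mono (sdiff_subset_sdiff_left sdiff_subset)).trans hAR
      refine ENNReal.le_of_add_le_add_right hδ ?_
      calc δ + δ = 2 * δ := (two_mul δ).symm
        _ ≤ _ := hAr
        _ = _ := h1.symm
        _ ≤ _ := by gcongr)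
  obtain ⟨h, H⟩ := exists_isFold_mirror hv τ
  refine ⟨_, h, H, le_trans ?_ (H.volume_polarization_diff_ball_add_le hA r)⟩
  gcongr
  exact hle.trans (measure_mono (inter_subset_inter_left _ inter_subset_left))

/-- Riesz's rearrangement inequality for two sets and a radially nonincreasing kernel. -/
theorem rieszFunctional_le_ball {k : V → ℝ≥0∞} (hk : Measurable k)
    (hdec : ∀ x y, ‖x‖ ≤ ‖y‖ → k y ≤ k x) (hkint : ∫⁻ z, k z ≠ ⊤) {A B : Set V}
    (hA : MeasurableSet A) (hB : MeasurableSet B) {r s : ℝ}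
    (hr : volume (Metric.ball (0 : V) r) = volume A)
    (hs : volume (Metric.ball (0 : V) s) = volume B) :
    rieszFunctional k A B ≤ rieszFunctional k (Metric.ball 0 r) (Metric.ball 0 s) := by
  have hAfin : volume A ≠ ⊤ := hr ▸ measure_ball_lt_top.ne
  have hBfin : volume B ≠ ⊤ := hs ▸ measure_ball_lt_top.ne
  let C : Set (Set V × Set V) := {p | (MeasurableSet p.1 ∧ MeasurableSet p.2) ∧
    (volume p.1 = volume A ∧ volume p.2 = volume B) ∧
    (∀ R, volume (p.1 \ Metric.ball 0 R) ≤ volume (A \ Metric.ball 0 R)) ∧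
    (∀ R, volume (p.2 \ Metric.ball 0 R) ≤ volume (B \ Metric.ball 0 R)) ∧
    rieszFunctional k A B ≤ rieszFunctional k p.1 p.2}
  let D : Set V × Set V → ℝ≥0∞ := fun p =>
    volume (p.1 \ Metric.ball 0 r) + volume (p.2 \ Metric.ball 0 s)
  have hABC : (A, B) ∈ C := ⟨⟨hA, hB⟩, ⟨rfl, rfl⟩, fun _ => le_rfl, fun _ => le_rfl, le_rfl⟩
  have hfold : ∀ p ∈ C, ∀ (σ : V → V) (h : V → ℝ), IsFold σ h →
      (polarization σ h p.1, polarization σ h p.2) ∈ C := by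
    rintro p ⟨⟨m1, m2⟩, ⟨v1, v2⟩, b1, b2, hI⟩ σ h H
    exact ⟨⟨H.measurableSet_polarization m1, H.measurableSet_polarization m2⟩,
      ⟨(H.volume_polarization m1).trans v1, (H.volume_polarization m2).trans v2⟩,
      fun R => (le_self_add.trans (H.volume_polarization_diff_ball_add_le m1 R)).trans (b1 R),
      fun R => (le_self_add.trans (H.volume_polarization_diff_ball_add_le m2 R)).trans (b2 R),
      hI.trans (H.rieszFunctional_le_polarization hk hdec m1 m2)⟩
  have hne : (D '' C).Nonempty := ⟨_, mem_image_of_mem D hABC⟩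
  have hinf : sInf (D '' C) = 0 := by
    by_contra hpos
    set d := sInf (D '' C) with hd
    have hdle : ∀ p ∈ C, d ≤ D p := fun p hp => sInf_le (mem_image_of_mem D hp)
    have hdfin : d ≠ ⊤ := ne_top_of_le_ne_top
      (ENNReal.add_ne_top.2 ⟨measure_ne_top_of_subset sdiff_subset hAfin,
        measure_ne_top_of_subset sdiff_subset hBfin⟩) (hdle _ hABC)
    have : Nontrivial V := by
      have h0 : D (A, B) ≠ 0 := fun h0 => hpos (le_antisymm (h0 ▸ hdle _ hABC) zero_le)
      by_cases h1 : volume (A \ Metric.ball 0 r) = 0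
      · exact nontrivial_of_volume_diff_ball_ne_zero hB hs fun h2 => h0 (by simp [D, h1, h2])
      · exact nontrivial_of_volume_diff_ball_ne_zero hA hr h1
    set δ := d / 2 / 2 with hδdef
    have hδ2 : 2 * δ = d / 2 := ENNReal.mul_div_cancel (by simp) (by simp)
    have hδ0 : δ ≠ 0 := (ENNReal.half_pos (ENNReal.half_pos hpos).ne').ne'
    have hδ : δ ≠ ⊤ := ENNReal.div_ne_top (ENNReal.div_ne_top hdfin (by simp)) (by simp)
    obtain ⟨R₁, hR₁⟩ := exists_volume_diff_ball_le hA hAfin hδ0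
    obtain ⟨R₂, hR₂⟩ := exists_volume_diff_ball_le hB hBfin hδ0
    set R := max (max r s) (max R₁ R₂) with hR
    obtain ⟨ε, hε0, hε⟩ := exists_mirror_overlap (V := V) R hδ0 hδ
    obtain ⟨_, ⟨p, hpC, rfl⟩, hp⟩ := sInf_lt_iff.1
      (show sInf (D '' C) < d + ε from ENNReal.lt_add_right hdfin hε0)
    obtain ⟨⟨m1, m2⟩, ⟨v1, v2⟩, b1, b2, -⟩ := id hpC
    suffices ∃ (σ : V → V) (h : V → ℝ), IsFold σ h ∧
        D (polarization σ h p.1, polarization σ h p.2) + ε ≤ D p by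
      obtain ⟨σ, h, H, hle⟩ := this
      refine absurd (le_trans ?_ hle) (not_le.2 hp)
      gcongr
      exact hdle _ (hfold p hpC σ h H)
    have hcase : d / 2 ≤ volume (p.1 \ Metric.ball 0 r) ∨
        d / 2 ≤ volume (p.2 \ Metric.ball 0 s) := by
      by_contra! hcon
      have := ENNReal.add_lt_add hcon.1 hcon.2
      rw [ENNReal.add_halves] at this
      exact absurd (hdle p hpC) (not_le.2 this)
    rcases hcase with hc | hc
    · obtain ⟨σ, h, H, hle⟩ := exists_isFold_volume_diff_ball_add_le (R := R) m1 (hr.trans v1.symm)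
        (by simp [hR]) hδ (hδ2.le.trans hc) ((b1 R).trans (hR₁ R (by simp [hR]))) hε
      refine ⟨σ, h, H, ?_⟩
      have h2 := le_self_add.trans (H.volume_polarization_diff_ball_add_le m2 s)
      calc _ = (volume (polarization σ h p.1 \ Metric.ball 0 r) + ε)
            + volume (polarization σ h p.2 \ Metric.ball 0 s) := by simp only [D]; ring
        _ ≤ _ := add_le_add hle h2
    · obtain ⟨σ, h, H, hle⟩ := exists_isFold_volume_diff_ball_add_le (R := R) m2 (hs.trans v2.symm)
        (by simp [hR]) hδ (hδ2.le.trans hc) ((b2 R).trans (hR₂ R (by simp [hR]))) hε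
      refine ⟨σ, h, H, ?_⟩
      have h1 := le_self_add.trans (H.volume_polarization_diff_ball_add_le m1 r)
      calc _ = volume (polarization σ h p.1 \ Metric.ball 0 r)
            + (volume (polarization σ h p.2 \ Metric.ball 0 s) + ε) := by simp only [D]; ring
        _ ≤ _ := add_le_add h1 hle
  obtain ⟨u, -, hu, humem⟩ := exists_seq_tendsto_sInf hne (OrderBot.bddBelow _)
  rw [hinf] at hu
  have hlim : Filter.Tendsto (fun n => rieszFunctional k (Metric.ball 0 r) (Metric.ball 0 s)
      + (∫⁻ z, k z) * u n) Filter.atTop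
      (nhds (rieszFunctional k (Metric.ball 0 r) (Metric.ball 0 s) + (∫⁻ z, k z) * 0)) :=
    (ENNReal.Tendsto.const_mul hu (Or.inr hkint)).const_add _
  rw [mul_zero, add_zero] at hlim
  refine ge_of_tendsto' hlim fun n => ?_
  obtain ⟨p, ⟨-, -, -, -, hI⟩, hpu⟩ := humem n
  rw [← hpu]
  exact hI.trans (rieszFunctional_le_add hk _ _ _ _)

theorem rieszFunctional_compl_add {k : V → ℝ≥0∞} (hk : Measurable k) {A B : Set V}
    (hB : MeasurableSet B) :
    rieszFunctional k A Bᶜ + rieszFunctional k A B = (∫⁻ z, k z) * volume A := by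
  unfold rieszFunctional
  rw [← lintegral_add_left (measurable_setLIntegral_sub hk _), ← setLIntegral_const]
  refine lintegral_congr fun x => ?_
  rw [add_comm, lintegral_add_compl _ hB, lintegral_sub_left_eq_self k x]

theorem rieszFunctional_ball_compl_le {k : V → ℝ≥0∞} (hk : Measurable k)
    (hdec : ∀ x y, ‖x‖ ≤ ‖y‖ → k y ≤ k x) (hkint : ∫⁻ z, k z ≠ ⊤) {A B : Set V}
    (hA : MeasurableSet A) (hB : MeasurableSet B) {r s : ℝ}
    (hr : volume (Metric.ball (0 : V) r) = volume A)
    (hs : volume (Metric.ball (0 : V) s) = volume B) :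
    rieszFunctional k (Metric.ball 0 r) (Metric.ball 0 s)ᶜ ≤ rieszFunctional k A Bᶜ := by
  have hfin : rieszFunctional k A B ≠ ⊤ :=
    ne_top_of_le_ne_top (ENNReal.mul_ne_top hkint (hr ▸ measure_ball_lt_top.ne))
      (rieszFunctional_le_left A B)
  refine ENNReal.le_of_add_le_add_right hfin ?_
  calc _ ≤ rieszFunctional k (Metric.ball 0 r) (Metric.ball 0 s)ᶜ
        + rieszFunctional k (Metric.ball 0 r) (Metric.ball 0 s) := by
        gcongr
        exact rieszFunctional_le_ball hk hdec hkint hA hB hr hs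
    _ = _ := by
        rw [rieszFunctional_compl_add hk Metric.isOpen_ball.measurableSet,
          rieszFunctional_compl_add hk hB, hr]

end Riesz

theorem setLIntegral_prod_eq_lintegral_section {α β : Type*} [MeasurableSpace α]
    [MeasurableSpace β] {μ : Measure α} {ν : Measure β} [SFinite ν] {S : Set (α × β)}
    (hS : MeasurableSet S) {f : α × β → ℝ≥0∞} (hf : Measurable f) :
    ∫⁻ p in S, f p ∂(μ.prod ν) = ∫⁻ a, ∫⁻ x in {x | (a, x) ∈ S}, f (a, x) ∂ν ∂μ := by
  rw [← lintegral_indicator hS, lintegral_prod _ (hf.indicator hS).aemeasurable]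
  refine lintegral_congr fun a => ?_
  exact lintegral_indicator (measurable_prodMk_left hS) fun x => f (a, x)

theorem perK_eq_lintegral_sections {m : ℕ} {K : ℝ × EuclideanSpace ℝ (Fin m) → ℝ}
    (hK : Measurable K) {E : Set (ℝ × EuclideanSpace ℝ (Fin m))} (hE : MeasurableSet E) :
    perK K E = ∫⁻ a, ∫⁻ b, rieszFunctional (fun z => ENNReal.ofReal (K (a - b, z)))
      {x | (a, x) ∈ E ∩ {x | -π < x.1 ∧ x.1 < π}} {y | (b, y) ∈ E}ᶜ := by
  have hΩ : MeasurableSet {x : ℝ × EuclideanSpace ℝ (Fin m) | -π < x.1 ∧ x.1 < π} :=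
    (measurableSet_lt measurable_const measurable_fst).inter
      (measurableSet_lt measurable_fst measurable_const)
  have hk : Measurable fun q : (ℝ × EuclideanSpace ℝ (Fin m)) × ℝ × EuclideanSpace ℝ (Fin m) =>
      ENNReal.ofReal (K (q.1 - q.2)) :=
    (hK.comp (measurable_fst.sub measurable_snd)).ennreal_ofReal
  rw [perK, Measure.volume_eq_prod, setLIntegral_prod_eq_lintegral_section (hE.inter hΩ)
    (Measurable.lintegral_prod_right' hk)]
  refine lintegral_congr fun a => ?_
  have hin : ∀ x, ∫⁻ y in Eᶜ, ENNReal.ofReal (K ((a, x) - y)) ∂(volume.prod volume)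
      = ∫⁻ b, ∫⁻ y in {y | (b, y) ∈ E}ᶜ, ENNReal.ofReal (K (a - b, x - y)) := fun x =>
    setLIntegral_prod_eq_lintegral_section hE.compl (hk.comp measurable_prodMk_left)
  simp only [hin]
  rw [lintegral_lintegral_swap]
  · rfl
  · refine Measurable.aemeasurable ?_
    have hind : Measurable fun q : (EuclideanSpace ℝ (Fin m) × ℝ) × EuclideanSpace ℝ (Fin m) =>
        Eᶜ.indicator (1 : ℝ × EuclideanSpace ℝ (Fin m) → ℝ≥0∞) (q.1.2, q.2)
          * ENNReal.ofReal (K (a - q.1.2, q.1.1 - q.2)) := by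
      have h1 : Measurable fun q : (EuclideanSpace ℝ (Fin m) × ℝ) × EuclideanSpace ℝ (Fin m) =>
          (q.1.2, q.2) := by fun_prop
      have h2 : Measurable fun q : (EuclideanSpace ℝ (Fin m) × ℝ) × EuclideanSpace ℝ (Fin m) =>
          (a - q.1.2, q.1.1 - q.2) := by fun_prop
      exact ((measurable_one.indicator hE.compl).comp h1).mul (hK.comp h2).ennreal_ofReal
    convert Measurable.lintegral_prod_right' (ν := volume) hind using 2 with q
    obtain ⟨x, b⟩ := q
    have hs : MeasurableSet {y | (b, y) ∈ E}ᶜ := (measurable_prodMk_left hE).compl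
    simp only [Function.uncurry]
    rw [← lintegral_indicator hs]
    refine lintegral_congr fun y => ?_
    by_cases hy : (b, y) ∈ E <;> simp [hy]

theorem stmt0 {m : ℕ} (K : ℝ × EuclideanSpace ℝ (Fin m) → ℝ)
    (hKmeas : Measurable K) (hKnonneg : ∀ x, 0 ≤ K x)
    (hKrot : ∀ (x₁ : ℝ)
      (R : EuclideanSpace ℝ (Fin m) ≃ₗᵢ[ℝ] EuclideanSpace ℝ (Fin m))
      (x' : EuclideanSpace ℝ (Fin m)), K (x₁, R x') = K (x₁, x'))
    (hKdec : ∀ (x₁ : ℝ) (x' y' : EuclideanSpace ℝ (Fin m)),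
      ‖x'‖ ≤ ‖y'‖ → K (x₁, y') ≤ K (x₁, x'))
    (hKint : ∀ x₁ : ℝ, x₁ ≠ 0 → Integrable (fun x' => K (x₁, x')) volume)
    (E Ecyl : Set (ℝ × EuclideanSpace ℝ (Fin m)))
    (hE : MeasurableSet E) (hEcyl : MeasurableSet Ecyl)
    (hEfin : volume (E ∩ {x : ℝ × EuclideanSpace ℝ (Fin m) | -π < x.1 ∧ x.1 < π}) < ⊤)
    (hsec : ∀ x₁ : ℝ,
      (volume {x' | (x₁, x') ∈ E} = ⊤ → {x' | (x₁, x') ∈ Ecyl} = Set.univ) ∧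
      (volume {x' | (x₁, x') ∈ E} ≠ ⊤ → ∃ r : ℝ, 0 ≤ r ∧
        {x' | (x₁, x') ∈ Ecyl} = Metric.ball (0 : EuclideanSpace ℝ (Fin m)) r ∧
        volume (Metric.ball (0 : EuclideanSpace ℝ (Fin m)) r)
          = volume {x' | (x₁, x') ∈ E})) :
    perK K Ecyl ≤ perK K E := by
  rw [perK_eq_lintegral_sections hKmeas hE, perK_eq_lintegral_sections hKmeas hEcyl]
  have hΩ : MeasurableSet {x : ℝ × EuclideanSpace ℝ (Fin m) | -π < x.1 ∧ x.1 < π} :=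
    (measurableSet_lt measurable_const measurable_fst).inter
      (measurableSet_lt measurable_fst measurable_const)
  rw [Measure.volume_eq_prod] at hEfin
  refine lintegral_mono_ae ?_
  filter_upwards [Measure.ae_measure_lt_top (hE.inter hΩ) hEfin.ne] with a ha
  by_cases haΩ : -π < a ∧ a < π
  swap
  · simp [rieszFunctional, haΩ]
  refine lintegral_mono_ae ?_
  filter_upwards [Measure.ae_ne volume a] with b hb
  have hsecΩ : ∀ F : Set (ℝ × EuclideanSpace ℝ (Fin m)),
      {x | (a, x) ∈ F ∩ {x | -π < x.1 ∧ x.1 < π}} = {x | (a, x) ∈ F} := by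
    intro F
    ext x
    simp [haΩ]
  have ha' : volume {x | (a, x) ∈ E} ≠ ⊤ := by
    rw [← hsecΩ E]
    exact ha.ne
  rw [hsecΩ, hsecΩ]
  have hk : Measurable fun z => ENNReal.ofReal (K (a - b, z)) :=
    (hKmeas.comp measurable_prodMk_left).ennreal_ofReal
  obtain ⟨r, -, hr, hrv⟩ := (hsec a).2 ha'
  by_cases hbt : volume {y | (b, y) ∈ E} = ⊤
  · simp [rieszFunctional, (hsec b).1 hbt]
  · obtain ⟨s, -, hs, hsv⟩ := (hsec b).2 hbt
    rw [hr, hs]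
    exact rieszFunctional_ball_compl_le hk
      (fun x y hxy => ENNReal.ofReal_le_ofReal (hKdec _ x y hxy))
      (hKint _ (sub_ne_zero.2 hb.symm)).lintegral_lt_top.ne
      (measurable_prodMk_left hE) (measurable_prodMk_left hE) hrv hsv
end

section
/- For every t > 0, the periodic heat kernel Λ_t(s) = (4πt)^{-1/2} Σ_{k ∈ ℤ} exp(−(s + 2πk)²/(4t)) is strictly decreasing in s on the interval (0, π). -/
open Real

/-- The reciprocal of the `q`-Pochhammer symbol `(Q; Q)_n`, extended by zero to negative `n`. -/
noncomputable def qPochInv (Q : ℝ) (n : ℤ) : ℝ :=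
  if n < 0 then 0 else (∏ j ∈ Finset.range n.toNat, (1 - Q ^ (j + 1)))⁻¹

section qPochInv

variable {Q : ℝ}

theorem one_sub_pow_succ_pos (h0 : 0 < Q) (h1 : Q < 1) (j : ℕ) : 0 < 1 - Q ^ (j + 1) :=
  sub_pos.2 (pow_lt_one₀ h0.le h1 j.succ_ne_zero)

theorem qPochInv_natCast (Q : ℝ) (n : ℕ) :
    qPochInv Q n = (∏ j ∈ Finset.range n, (1 - Q ^ (j + 1)))⁻¹ := by
  simp [qPochInv]

theorem qPochInv_of_neg (Q : ℝ) {n : ℤ} (hn : n < 0) : qPochInv Q n = 0 := if_pos hn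

theorem qPochInv_sub_one (h0 : 0 < Q) (h1 : Q < 1) (n : ℤ) :
    qPochInv Q (n - 1) = (1 - Q ^ n) * qPochInv Q n := by
  rcases lt_trichotomy n 0 with hn | rfl | hn
  · rw [qPochInv_of_neg Q hn, qPochInv_of_neg Q (by omega), mul_zero]
  · simp [qPochInv]
  · obtain ⟨m, rfl⟩ : ∃ m : ℕ, n = (m + 1 : ℕ) := ⟨(n - 1).toNat, by omega⟩
    rw [show ((m + 1 : ℕ) : ℤ) - 1 = (m : ℤ) by push_cast; ring, qPochInv_natCast,
      qPochInv_natCast, Finset.prod_range_succ, zpow_natCast, mul_inv]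
    have := (one_sub_pow_succ_pos h0 h1 m).ne'
    field_simp

theorem exists_tendsto_qPochInv (h0 : 0 < Q) (h1 : Q < 1) :
    ∃ C : ℝ, 0 < C ∧ (∀ n : ℤ, 0 ≤ qPochInv Q n ∧ qPochInv Q n ≤ C) ∧
      Filter.Tendsto (qPochInv Q) Filter.atTop (nhds C) := by
  have hpos (n : ℕ) : 0 < ∏ j ∈ Finset.range n, (1 - Q ^ (j + 1)) :=
    Finset.prod_pos fun j _ => one_sub_pow_succ_pos h0 h1 j
  have hsum : Summable fun j : ℕ => ‖-Q ^ (j + 1)‖ := by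
    simpa [abs_of_pos h0] using
      (summable_nat_add_iff 1).mpr (summable_geometric_of_lt_one h0.le h1)
  have hne : ∏' j : ℕ, (1 - Q ^ (j + 1)) ≠ 0 := by
    simpa [sub_eq_add_neg] using tprod_one_add_ne_zero_of_summable
      (f := fun j : ℕ => -Q ^ (j + 1))
      (fun j => by simpa [sub_eq_add_neg] using (one_sub_pow_succ_pos h0 h1 j).ne') hsum
  have hlim : Filter.Tendsto (fun n : ℕ => ∏ j ∈ Finset.range n, (1 - Q ^ (j + 1)))
      Filter.atTop (nhds (∏' j : ℕ, (1 - Q ^ (j + 1)))) := by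
    have hm : Multipliable fun j : ℕ => (1 - Q ^ (j + 1)) := by
      simpa [sub_eq_add_neg] using multipliable_one_add_of_summable hsum
    exact hm.hasProd.tendsto_prod_nat
  have hanti : Antitone fun n : ℕ => ∏ j ∈ Finset.range n, (1 - Q ^ (j + 1)) := by
    refine antitone_nat_of_succ_le fun n => ?_
    rw [Finset.prod_range_succ]
    exact mul_le_of_le_one_right (hpos n).le (by linarith [pow_pos h0 (n + 1)])
  have hL : 0 < ∏' j : ℕ, (1 - Q ^ (j + 1)) :=
    (ge_of_tendsto' hlim fun n => (hpos n).le).lt_of_ne' hne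
  refine ⟨(∏' j : ℕ, (1 - Q ^ (j + 1)))⁻¹, inv_pos.2 hL, fun n => ?_, ?_⟩
  · rcases lt_or_ge n 0 with hn | hn
    · rw [qPochInv_of_neg Q hn]
      exact ⟨le_rfl, (inv_pos.2 hL).le⟩
    · lift n to ℕ using hn
      rw [qPochInv_natCast]
      exact ⟨(inv_pos.2 (hpos n)).le, inv_anti₀ hL (hanti.le_of_tendsto hlim n)⟩
  · have htoNat : Filter.Tendsto Int.toNat Filter.atTop Filter.atTop :=
      Filter.tendsto_atTop_atTop.2 fun n => ⟨n, fun m hm => by omega⟩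
    refine ((hlim.inv₀ hne).comp htoNat).congr' ?_
    filter_upwards [Filter.eventually_ge_atTop 0] with n hn
    simp [qPochInv, hn.not_gt]

end qPochInv

theorem summable_exp_neg_int_quadratic {a : ℝ} (ha : 0 < a) (b : ℝ) :
    Summable fun k : ℤ => exp (-π * (k : ℝ) ^ 2 * a - 2 * π * k * b) := by
  have h := ((summable_jacobiTheta₂_term_iff (b * Complex.I) (a * Complex.I)).2
    (by simpa using ha)).norm
  simpa [norm_jacobiTheta₂_term] using h

/-- The coefficients of the finite Jacobi triple product, up to a factor independent of `k`. -/
noncomputable def thetaWeight (q : ℝ) (N : ℕ) (k : ℤ) : ℝ :=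
  qPochInv (q ^ 2) (N + k) * qPochInv (q ^ 2) (N - k) * q ^ (k ^ 2)

/-- The trigonometric polynomial given by the finite Jacobi triple product, up to a constant
factor. -/
noncomputable def finiteTheta (q : ℝ) (N : ℕ) (s : ℝ) : ℝ :=
  ∑' k : ℤ, thetaWeight q N k * cos (k * s)

section finiteTheta

variable {q : ℝ}

theorem summable_zpow_sq (h0 : 0 < q) (h1 : q < 1) : Summable fun k : ℤ => q ^ (k ^ 2) := by
  have h := summable_exp_neg_int_quadratic (a := -log q / π)
    (div_pos (neg_pos.2 (log_neg h0 h1)) pi_pos) 0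
  refine h.congr fun k => ?_
  rw [← rpow_intCast, rpow_def_of_pos h0]
  congr 1
  push_cast
  field_simp
  ring

theorem tendsto_finiteTheta (h0 : 0 < q) (h1 : q < 1) :
    ∃ C : ℝ, 0 < C ∧ ∀ s, Filter.Tendsto (fun N => finiteTheta q N s) Filter.atTop
      (nhds (C * ∑' k : ℤ, q ^ (k ^ 2) * cos (k * s))) := by
  obtain ⟨C, hC, hb, hlim⟩ :=
    exists_tendsto_qPochInv (pow_pos h0 2) (pow_lt_one₀ h0.le h1 two_ne_zero)
  refine ⟨C * C, mul_pos hC hC, fun s => ?_⟩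
  rw [← tsum_mul_left]
  refine tendsto_tsum_of_dominated_convergence (bound := fun k : ℤ => C * C * q ^ (k ^ 2))
    ((summable_zpow_sq h0 h1).mul_left _) (fun k => ?_) (.of_forall fun N k => ?_)
  · have hN : Filter.Tendsto (fun N : ℕ => (N : ℤ)) Filter.atTop Filter.atTop :=
      tendsto_natCast_atTop_atTop
    have h₁ := hlim.comp (Filter.tendsto_atTop_add_const_right _ k hN)
    have h₂ := hlim.comp (Filter.tendsto_atTop_add_const_right _ (-k) hN)
    simpa [thetaWeight, Function.comp_def, sub_eq_add_neg, mul_assoc] using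
      (h₁.mul h₂).mul_const (q ^ (k ^ 2) * cos (k * s))
  · have hq : 0 < q ^ (k ^ 2) := zpow_pos h0 _
    rw [thetaWeight, norm_mul, norm_mul, norm_mul, norm_of_nonneg (hb _).1, norm_of_nonneg (hb _).1,
      norm_of_nonneg hq.le]
    refine (mul_le_of_le_one_right ?_ (abs_cos_le_one _)).trans ?_
    · exact mul_nonneg (mul_nonneg (hb _).1 (hb _).1) hq.le
    · gcongr
      exacts [(hb _).1, (hb _).2, (hb _).2]

theorem summable_thetaWeight_mul (q : ℝ) (N : ℕ) (g : ℤ → ℝ) :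
    Summable fun k => thetaWeight q N k * g k := by
  refine summable_of_hasFiniteSupport ((Set.finite_Icc (-N : ℤ) N).subset fun k hk => ?_)
  by_contra h
  rw [Set.mem_Icc, not_and_or, not_le, not_le] at h
  refine hk ?_
  rcases h with h | h
  · simp [thetaWeight, qPochInv_of_neg (q ^ 2) (show (N : ℤ) + k < 0 by omega)]
  · simp [thetaWeight, qPochInv_of_neg (q ^ 2) (show (N : ℤ) - k < 0 by omega)]

theorem thetaWeight_succ (h0 : 0 < q) (h1 : q < 1) (N : ℕ) (k : ℤ) :
    (1 - q ^ (4 * N + 2)) * (1 - q ^ (4 * N + 4)) * thetaWeight q (N + 1) k =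
      (1 + q ^ (4 * N + 2)) * thetaWeight q N k +
        q ^ (2 * N + 1) * (thetaWeight q N (k - 1) + thetaWeight q N (k + 1)) := by
  have hstep := qPochInv_sub_one (pow_pos h0 2) (pow_lt_one₀ h0.le h1 two_ne_zero)
  have hq := h0.ne'
  have e₁ := hstep (N + 1 + k)
  have e₂ := hstep (N + 1 - k)
  have e₃ := hstep (N + k)
  have e₄ := hstep (N - k)
  have hx : q ^ k ≠ 0 := zpow_ne_zero _ hq
  rw [show (N + 1 + k - 1 : ℤ) = N + k by ring] at e₁
  rw [show (N + 1 - k - 1 : ℤ) = N - k by ring] at e₂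
  have z₁ : (q ^ 2) ^ (N + k : ℤ) = (q ^ N) ^ 2 * (q ^ k) ^ 2 := by
    rw [zpow_add₀ (pow_ne_zero 2 hq), zpow_natCast, ← pow_mul, ← pow_mul, mul_comm 2 N,
      ← zpow_natCast q 2, ← zpow_mul, ← zpow_natCast (q ^ k) 2, ← zpow_mul, mul_comm k]
  have z₂ : (q ^ 2) ^ (N - k : ℤ) = (q ^ N) ^ 2 / (q ^ k) ^ 2 := by
    rw [zpow_sub₀ (pow_ne_zero 2 hq), zpow_natCast, ← pow_mul, ← pow_mul, mul_comm 2 N,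
      ← zpow_natCast q 2, ← zpow_mul, ← zpow_natCast (q ^ k) 2, ← zpow_mul, mul_comm k]
  have z₃ : (q ^ 2) ^ (N + 1 + k : ℤ) = q ^ 2 * ((q ^ N) ^ 2 * (q ^ k) ^ 2) := by
    rw [← z₁, ← zpow_one_add₀ (pow_ne_zero 2 hq)]
    congr 1
    ring
  have z₄ : (q ^ 2) ^ (N + 1 - k : ℤ) = q ^ 2 * ((q ^ N) ^ 2 / (q ^ k) ^ 2) := by
    rw [← z₂, ← zpow_one_add₀ (pow_ne_zero 2 hq)]
    congr 1
    ring
  have w₁ : q ^ ((k - 1) ^ 2) = q ^ (k ^ 2) * q / (q ^ k) ^ 2 := by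
    rw [← zpow_natCast (q ^ k) 2, ← zpow_mul, ← zpow_add_one₀ hq, ← zpow_sub₀ hq]
    congr 1
    push_cast
    ring
  have w₂ : q ^ ((k + 1) ^ 2) = q ^ (k ^ 2) * q * (q ^ k) ^ 2 := by
    rw [← zpow_natCast (q ^ k) 2, ← zpow_mul, ← zpow_add_one₀ hq, ← zpow_add₀ hq]
    congr 1
    push_cast
    ring
  have p₁ : q ^ (4 * N + 2) = (q ^ N) ^ 4 * q ^ 2 := by ring
  have p₂ : q ^ (4 * N + 4) = (q ^ N) ^ 4 * q ^ 4 := by ring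
  have p₃ : q ^ (2 * N + 1) = (q ^ N) ^ 2 * q := by ring
  simp only [thetaWeight, Nat.cast_add, Nat.cast_one]
  rw [show (N + (k - 1) : ℤ) = N + k - 1 by ring, show (N - (k - 1) : ℤ) = N + 1 - k by ring,
    show (N + (k + 1) : ℤ) = N + 1 + k by ring, show (N - (k + 1) : ℤ) = N - k - 1 by ring,
    e₃, e₄, e₁, e₂, z₁, z₂, z₃, z₄, w₁, w₂, p₁, p₂, p₃]
  field_simp
  ring

theorem finiteTheta_succ (h0 : 0 < q) (h1 : q < 1) (N : ℕ) (s : ℝ) :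
    (1 - q ^ (4 * N + 2)) * (1 - q ^ (4 * N + 4)) * finiteTheta q (N + 1) s =
      (1 + 2 * q ^ (2 * N + 1) * cos s + q ^ (4 * N + 2)) * finiteTheta q N s := by
  have hs (M : ℕ) := (summable_thetaWeight_mul q M fun k => cos (k * s)).hasSum
  have hp := (summable_thetaWeight_mul q N fun k => cos ((k + 1 : ℤ) * s)).hasSum
  have hm := (summable_thetaWeight_mul q N fun k => cos ((k - 1 : ℤ) * s)).hasSum
  have hpm := (hp.add hm).unique (((hs N).mul_left (2 * cos s)).congr_fun fun k => by
    have e₁ : ((k + 1 : ℤ) : ℝ) * s = k * s + s := by push_cast; ring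
    have e₂ : ((k - 1 : ℤ) : ℝ) * s = k * s - s := by push_cast; ring
    rw [e₁, e₂, cos_add, cos_sub]
    ring)
  have hp' := (Equiv.subRight (1 : ℤ)).hasSum_iff.2 hp
  have hm' := (Equiv.addRight (1 : ℤ)).hasSum_iff.2 hm
  have h := (((hs N).mul_left (1 + q ^ (4 * N + 2))).add
    ((hp'.add hm').mul_left (q ^ (2 * N + 1)))).unique
    (((hs (N + 1)).mul_left ((1 - q ^ (4 * N + 2)) * (1 - q ^ (4 * N + 4)))).congr_fun fun k => by
      simp only [Function.comp_apply, Equiv.subRight_apply, Equiv.coe_addRight, sub_add_cancel,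
        add_sub_cancel_right]
      linear_combination -cos (k * s) * thetaWeight_succ h0 h1 N k)
  rw [hpm] at h
  simp only [finiteTheta]
  linear_combination -h

theorem finiteTheta_zero (q s : ℝ) : finiteTheta q 0 s = 1 := by
  rw [finiteTheta, tsum_eq_single 0]
  · simp [thetaWeight, qPochInv]
  · intro k hk
    rcases hk.lt_or_gt with h | h
    · simp [thetaWeight, qPochInv_of_neg (q ^ 2) h]
    · simp [thetaWeight, qPochInv_of_neg (q ^ 2) (neg_lt_zero.2 h)]

theorem theta_factor_pos (h0 : 0 < q) (h1 : q < 1) (N : ℕ) (s : ℝ) :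
    0 < 1 + 2 * q ^ (2 * N + 1) * cos s + q ^ (4 * N + 2) := by
  have h : q ^ (2 * N + 1) < 1 := pow_lt_one₀ h0.le h1 (by omega)
  have h' : 0 < q ^ (2 * N + 1) := by positivity
  rw [show 4 * N + 2 = (2 * N + 1) * 2 by ring, pow_mul]
  nlinarith [neg_one_le_cos s]

theorem finiteTheta_pos (h0 : 0 < q) (h1 : q < 1) (N : ℕ) (s : ℝ) : 0 < finiteTheta q N s := by
  induction N with
  | zero => simp [finiteTheta_zero]
  | succ N ih =>
    have h := finiteTheta_succ h0 h1 N s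
    have h₁ := one_sub_pow_succ_pos h0 h1 (4 * N + 1)
    have h₂ := one_sub_pow_succ_pos h0 h1 (4 * N + 3)
    exact pos_of_mul_pos_right (h ▸ mul_pos (theta_factor_pos h0 h1 N s) ih) (mul_pos h₁ h₂).le

theorem finiteTheta_mul_le (h0 : 0 < q) (h1 : q < 1) {a b : ℝ} (hab : cos b ≤ cos a) (N : ℕ) :
    (1 + 2 * q * cos a + q ^ 2) * finiteTheta q (N + 1) b ≤
      (1 + 2 * q * cos b + q ^ 2) * finiteTheta q (N + 1) a := by
  induction N with
  | zero =>
    have ha := finiteTheta_succ h0 h1 0 a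
    have hb := finiteTheta_succ h0 h1 0 b
    simp only [mul_zero, zero_add, pow_one, finiteTheta_zero, mul_one] at ha hb ⊢
    rw [← ha, ← hb]
    apply le_of_eq
    ring
  | succ N ih =>
    have ha := finiteTheta_succ h0 h1 (N + 1) a
    have hb := finiteTheta_succ h0 h1 (N + 1) b
    have hc := mul_pos (one_sub_pow_succ_pos h0 h1 (4 * (N + 1) + 1))
      (one_sub_pow_succ_pos h0 h1 (4 * (N + 1) + 3))
    refine le_of_mul_le_mul_left ?_ hc
    have hf : 1 + 2 * q ^ (2 * (N + 1) + 1) * cos b + q ^ (4 * (N + 1) + 2) ≤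
        1 + 2 * q ^ (2 * (N + 1) + 1) * cos a + q ^ (4 * (N + 1) + 2) := by gcongr
    have ha₁ : 0 < 1 + 2 * q * cos a + q ^ 2 := by simpa using theta_factor_pos h0 h1 0 a
    calc _ = (1 + 2 * q ^ (2 * (N + 1) + 1) * cos b + q ^ (4 * (N + 1) + 2)) *
          ((1 + 2 * q * cos a + q ^ 2) * finiteTheta q (N + 1) b) := by
            linear_combination (1 + 2 * q * cos a + q ^ 2) * hb
      _ ≤ (1 + 2 * q ^ (2 * (N + 1) + 1) * cos a + q ^ (4 * (N + 1) + 2)) *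
          ((1 + 2 * q * cos b + q ^ 2) * finiteTheta q (N + 1) a) :=
            mul_le_mul hf ih (mul_pos ha₁ (finiteTheta_pos h0 h1 _ _)).le
              (theta_factor_pos h0 h1 _ _).le
      _ = _ := by linear_combination -(1 + 2 * q * cos b + q ^ 2) * ha

end finiteTheta

theorem tsum_zpow_sq_mul_cos_lt {q : ℝ} (h0 : 0 < q) (h1 : q < 1) {a b : ℝ}
    (hab : cos b < cos a) (hb : 0 < ∑' k : ℤ, q ^ (k ^ 2) * cos (k * b)) :
    ∑' k : ℤ, q ^ (k ^ 2) * cos (k * b) < ∑' k : ℤ, q ^ (k ^ 2) * cos (k * a) := by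
  obtain ⟨C, hC, hlim⟩ := tendsto_finiteTheta h0 h1
  have h := le_of_tendsto_of_tendsto'
    (((hlim b).comp (Filter.tendsto_add_atTop_nat 1)).const_mul (1 + 2 * q * cos a + q ^ 2))
    (((hlim a).comp (Filter.tendsto_add_atTop_nat 1)).const_mul (1 + 2 * q * cos b + q ^ 2))
    (finiteTheta_mul_le h0 h1 hab.le)
  have hb₁ : 0 < 1 + 2 * q * cos b + q ^ 2 := by simpa using theta_factor_pos h0 h1 0 b
  refine lt_of_mul_lt_mul_left ?_ (mul_pos hb₁ hC).le
  have hlt : (1 + 2 * q * cos b + q ^ 2) * (C * ∑' k : ℤ, q ^ (k ^ 2) * cos (k * b)) <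
      (1 + 2 * q * cos a + q ^ 2) * (C * ∑' k : ℤ, q ^ (k ^ 2) * cos (k * b)) := by
    gcongr
  linarith

theorem tsum_exp_neg_periodic_pos {t : ℝ} (ht : 0 < t) (s : ℝ) :
    0 < ∑' k : ℤ, exp (-(s + 2 * π * (k : ℝ)) ^ 2 / (4 * t)) := by
  have h : Summable fun k : ℤ => exp (-(s + 2 * π * (k : ℝ)) ^ 2 / (4 * t)) := by
    refine ((summable_exp_neg_int_quadratic (a := π / t) (by positivity)
      (s / (2 * t))).mul_left (exp (-s ^ 2 / (4 * t)))).congr fun k => ?_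
    rw [← exp_add]
    congr 1
    field_simp
    ring
  exact h.tsum_pos (fun k => (exp_pos _).le) 0 (exp_pos _)

theorem tsum_zpow_sq_mul_cos_eq {t : ℝ} (ht : 0 < t) (s : ℝ) :
    ∑' k : ℤ, exp (-t) ^ (k ^ 2) * cos (k * s) =
      (1 / (t / π) ^ (1 / 2 : ℝ)) * ∑' k : ℤ, exp (-(s + 2 * π * (k : ℝ)) ^ 2 / (4 * t)) := by
  have h := Complex.tsum_exp_neg_quadratic (a := ((t / π : ℝ) : ℂ))
    (by rw [Complex.ofReal_re]; positivity) (-Complex.I * s / (2 * π))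
  have hπ : (π : ℂ) ≠ 0 := Complex.ofReal_ne_zero.2 pi_ne_zero
  have hterm (k : ℤ) : -π / ((t / π : ℝ) : ℂ) *
      (k + Complex.I * (-Complex.I * s / (2 * π))) ^ 2 =
        ((-(s + 2 * π * (k : ℝ)) ^ 2 / (4 * t) : ℝ) : ℂ) := by
    have hI : Complex.I * (-Complex.I * s / (2 * π)) = s / (2 * π) := by
      linear_combination (-s / (2 * π) : ℂ) * Complex.I_sq
    rw [hI]
    push_cast
    field_simp
    ring
  have hroot : (1 : ℂ) / ((t / π : ℝ) : ℂ) ^ (1 / 2 : ℂ) =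
      ((1 / (t / π) ^ (1 / 2 : ℝ) : ℝ) : ℂ) := by
    rw [Complex.ofReal_div (1 : ℝ), Complex.ofReal_cpow (by positivity)]
    norm_num
  have hexp (k : ℤ) : Complex.exp (-π * ((t / π : ℝ) : ℂ) * k ^ 2 +
      2 * π * (-Complex.I * s / (2 * π)) * k) =
        ((exp (-t) ^ (k ^ 2) : ℝ) : ℂ) * Complex.exp ((-(k * s) : ℝ) * Complex.I) := by
    rw [← rpow_intCast, ← exp_mul, Complex.ofReal_exp, ← Complex.exp_add]
    congr 1
    push_cast
    field_simp
  simp only [hterm, hroot, hexp, ← Complex.ofReal_exp] at h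
  rw [← Complex.ofReal_tsum, ← Complex.ofReal_mul] at h
  have hsum : Summable fun k : ℤ =>
      ((exp (-t) ^ (k ^ 2) : ℝ) : ℂ) * Complex.exp ((-(k * s) : ℝ) * Complex.I) := by
    refine .of_norm ((summable_zpow_sq (exp_pos (-t))
      (exp_lt_one_iff.2 (neg_lt_zero.2 ht))).congr fun k => ?_)
    rw [norm_mul, Complex.norm_exp_ofReal_mul_I, mul_one, Complex.norm_real,
      norm_of_nonneg (by positivity)]
  have hre := congrArg Complex.re h
  rw [Complex.re_tsum hsum, Complex.ofReal_re] at hre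
  rw [← hre]
  refine tsum_congr fun k => ?_
  rw [Complex.re_ofReal_mul, Complex.exp_ofReal_mul_I_re, cos_neg]

theorem stmt4 (t : ℝ) (ht : 0 < t) :
    StrictAntiOn (fun s : ℝ => (4 * π * t) ^ (-(1:ℝ)/2) *
      ∑' k : ℤ, Real.exp (-(s + 2 * π * (k : ℝ)) ^ 2 / (4 * t))) (Set.Ioo 0 π) := by
  intro a ha b hb hab
  have hcos : cos b < cos a :=
    strictAntiOn_cos (Set.Ioo_subset_Icc_self ha) (Set.Ioo_subset_Icc_self hb) hab
  have hc : 0 < 1 / (t / π) ^ (1 / 2 : ℝ) := by positivity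
  have h := tsum_zpow_sq_mul_cos_lt (exp_pos (-t)) (exp_lt_one_iff.2 (neg_lt_zero.2 ht)) hcos
    (tsum_zpow_sq_mul_cos_eq ht b ▸ mul_pos hc (tsum_exp_neg_periodic_pos ht b))
  rw [tsum_zpow_sq_mul_cos_eq ht, tsum_zpow_sq_mul_cos_eq ht] at h
  exact mul_lt_mul_of_pos_left (lt_of_mul_lt_mul_left h hc.le) (by positivity)
end

section
/- Let α ∈ (0,1), λ, Λ > 0, and let K : ℝⁿ → (0,∞) satisfy λ|x|^{−n−α} ≤ K(x) ≤ Λ|x|^{−n−α}. Let B_ω be the ball centered at 0 of volume ω, let 𝓑_ω = ⋃_{k∈ℤ}(B_ω + 2πk e₁) be the periodic array of balls, and let 𝓒_ω = {x : |x'| < R(ω)} be the straight cylinder with |𝓒_ω ∩ Ω| = ω. Then there exists ω₀ > 0, depending only on n, α, λ, Λ, such that for all 0 < ω < ω₀ one has P_K[𝓑_ω] < P_K[𝓒_ω]; in particular straight cylinders are not volume-constrained minimizers of P_K for small volumes. -/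
open MeasureTheory Set Real
open scoped ENNReal

section Nonlocal

variable {m : ℕ}

/-- The Euclidean norm on `ℝ × ℝᵐ`, whose instance norm is the sup norm. -/
noncomputable def euclNorm (x : ℝ × EuclideanSpace ℝ (Fin m)) : ℝ :=
  Real.sqrt (x.1 ^ 2 + ‖x.2‖ ^ 2)

lemma euclNorm_eq_norm_toLp (x : ℝ × EuclideanSpace ℝ (Fin m)) :
    euclNorm x = ‖WithLp.toLp 2 x‖ := by
  rw [WithLp.prod_norm_eq_of_L2, euclNorm]
  simp

lemma euclNorm_nonneg (x : ℝ × EuclideanSpace ℝ (Fin m)) : 0 ≤ euclNorm x :=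
  Real.sqrt_nonneg _

lemma euclNorm_sub_le (x y : ℝ × EuclideanSpace ℝ (Fin m)) :
    euclNorm (x - y) ≤ euclNorm x + euclNorm y := by
  simp only [euclNorm_eq_norm_toLp, WithLp.toLp_sub]
  exact norm_sub_le _ _

lemma euclNorm_smul (c : ℝ) (x : ℝ × EuclideanSpace ℝ (Fin m)) :
    euclNorm (c • x) = |c| * euclNorm x := by
  simp only [euclNorm_eq_norm_toLp, WithLp.toLp_smul, norm_smul, Real.norm_eq_abs]

lemma norm_le_euclNorm (x : ℝ × EuclideanSpace ℝ (Fin m)) : ‖x‖ ≤ euclNorm x := by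
  rw [Prod.norm_def, Real.norm_eq_abs]
  exact max_le (Real.abs_le_sqrt (by nlinarith [norm_nonneg x.2]))
    (Real.le_sqrt_of_sq_le (by nlinarith [sq_nonneg x.1]))

lemma euclNorm_le_add (x : ℝ × EuclideanSpace ℝ (Fin m)) : euclNorm x ≤ |x.1| + ‖x.2‖ := by
  refine Real.sqrt_le_iff.2 ⟨by positivity, ?_⟩
  nlinarith [sq_abs x.1, mul_nonneg (abs_nonneg x.1) (norm_nonneg x.2)]

lemma euclNorm_le_two_mul_norm (x : ℝ × EuclideanSpace ℝ (Fin m)) : euclNorm x ≤ 2 * ‖x‖ := by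
  have h₁ : |x.1| ≤ ‖x‖ := norm_fst_le x
  have h₂ := norm_snd_le x
  linarith [euclNorm_le_add x]

lemma continuous_euclNorm : Continuous (euclNorm (m := m)) := by
  unfold euclNorm
  fun_prop

lemma measurableSet_euclNorm_lt (r : ℝ) :
    MeasurableSet {x : ℝ × EuclideanSpace ℝ (Fin m) | euclNorm x < r} :=
  (isOpen_lt continuous_euclNorm continuous_const).measurableSet

lemma finrank_real_prod_euclideanSpace :
    Module.finrank ℝ (ℝ × EuclideanSpace ℝ (Fin m)) = m + 1 := by
  simp [Module.finrank_prod, add_comm]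

instance isAddHaarMeasure_volume_real_prod_euclideanSpace :
    (volume : Measure (ℝ × EuclideanSpace ℝ (Fin m))).IsAddHaarMeasure :=
  Measure.prod.instIsAddHaarMeasure volume volume

open scoped Pointwise in
lemma volume_euclNorm_lt {r : ℝ} (hr : 0 ≤ r) :
    volume {x : ℝ × EuclideanSpace ℝ (Fin m) | euclNorm x < r} =
      ENNReal.ofReal (r ^ (m + 1)) *
        volume {x : ℝ × EuclideanSpace ℝ (Fin m) | euclNorm x < 1} := by
  rcases hr.eq_or_lt with rfl | hr
  · have : {x : ℝ × EuclideanSpace ℝ (Fin m) | euclNorm x < 0} = ∅ :=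
      eq_empty_of_forall_notMem fun x hx => (euclNorm_nonneg x).not_gt hx
    simp [this]
  have : {x : ℝ × EuclideanSpace ℝ (Fin m) | euclNorm x < r} =
      r • {x : ℝ × EuclideanSpace ℝ (Fin m) | euclNorm x < 1} := by
    ext x
    rw [Set.mem_smul_set_iff_inv_smul_mem₀ hr.ne']
    simp only [mem_ofPred_eq, euclNorm_smul, abs_inv, abs_of_pos hr]
    rw [inv_mul_lt_iff₀ hr, mul_one]
  rw [this, Measure.addHaar_smul, finrank_real_prod_euclideanSpace, abs_of_pos (by positivity)]

lemma volume_euclNorm_lt_one_pos :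
    0 < volume {x : ℝ × EuclideanSpace ℝ (Fin m) | euclNorm x < 1} :=
  (isOpen_lt continuous_euclNorm continuous_const).measure_pos _
    ⟨0, by simp [euclNorm]⟩

lemma volume_euclNorm_lt_ne_top (r : ℝ) :
    volume {x : ℝ × EuclideanSpace ℝ (Fin m) | euclNorm x < r} ≠ ∞ := by
  have hball : volume (Metric.ball (0 : ℝ × EuclideanSpace ℝ (Fin m)) r) ≠ ∞ :=
    measure_ball_lt_top.ne
  refine measure_ne_top_of_subset (fun x hx => ?_) hball
  rw [mem_ball_zero_iff]
  exact (norm_le_euclNorm x).trans_lt hx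

/-- A ball and its translate by `z` differ by at most the shell of thickness `euclNorm z`. -/
lemma volume_ball_diff_translate_le {r : ℝ} (hr : 0 < r) (z : ℝ × EuclideanSpace ℝ (Fin m)) :
    volume {x | euclNorm x < r ∧ ¬ euclNorm (x - z) < r} ≤
      ENNReal.ofReal (2 * (m + 1) * min (‖z‖ / r) 1) *
        volume {x : ℝ × EuclideanSpace ℝ (Fin m) | euclNorm x < r} := by
  set s := min (euclNorm z / r) 1
  have hs₀ : 0 ≤ s := le_min (div_nonneg (euclNorm_nonneg z) hr.le) zero_le_one
  have hs₁ : s ≤ 1 := min_le_right _ _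
  have hsub : {x | euclNorm x < r ∧ ¬ euclNorm (x - z) < r} ⊆
      {x | euclNorm x < r} \ {x | euclNorm x < r * (1 - s)} := by
    rintro x ⟨hx, hxz⟩
    refine ⟨hx, fun hx' : euclNorm x < r * (1 - s) => hxz ?_⟩
    have h₁ := euclNorm_sub_le x z
    rcases min_choice (euclNorm z / r) 1 with h | h
    · have : r * s = euclNorm z := by
        simp only [s]
        rw [h]
        field_simp
      linarith
    · have : s = 1 := h
      rw [this] at hx'
      linarith [euclNorm_nonneg x]
  have hmono : {x : ℝ × EuclideanSpace ℝ (Fin m) | euclNorm x < r * (1 - s)} ⊆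
      {x | euclNorm x < r} := fun x hx => by
    rw [mem_ofPred_eq] at hx ⊢
    nlinarith
  have hs : s ≤ 2 * min (‖z‖ / r) 1 := by
    rw [mul_min_of_nonneg _ _ zero_le_two]
    refine min_le_min ?_ (by norm_num)
    rw [← mul_div_assoc]
    exact div_le_div_of_nonneg_right (euclNorm_le_two_mul_norm z) hr.le
  have hbern : 1 - (m + 1) * s ≤ (1 - s) ^ (m + 1) := by
    have := one_add_mul_le_pow (a := -s) (by linarith) (m + 1)
    push_cast at this
    rw [← sub_eq_add_neg] at this
    linarith
  calc _ ≤ volume ({x : ℝ × EuclideanSpace ℝ (Fin m) | euclNorm x < r} \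
          {x | euclNorm x < r * (1 - s)}) := measure_mono hsub
    _ = volume {x : ℝ × EuclideanSpace ℝ (Fin m) | euclNorm x < r} -
          volume {x : ℝ × EuclideanSpace ℝ (Fin m) | euclNorm x < r * (1 - s)} :=
        measure_sdiff hmono (measurableSet_euclNorm_lt _).nullMeasurableSet
          (volume_euclNorm_lt_ne_top _)
    _ ≤ _ := by
      rw [volume_euclNorm_lt hr.le, volume_euclNorm_lt (mul_nonneg hr.le (by linarith)),
        ← mul_assoc, ← ENNReal.ofReal_mul (by positivity)]
      rw [← ENNReal.sub_mul fun _ _ => volume_euclNorm_lt_ne_top _,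
        ← ENNReal.ofReal_sub _ (by have : 0 ≤ 1 - s := by linarith
                                   positivity)]
      gcongr
      rw [mul_pow, ← mul_one_sub, mul_comm]
      gcongr
      nlinarith [mul_le_mul_of_nonneg_left hs (show (0 : ℝ) ≤ m + 1 by positivity)]

lemma setLIntegral_setLIntegral_compl_sub {G : Type*} [AddCommGroup G] [MeasurableSpace G]
    [MeasurableAdd₂ G] [MeasurableNeg G] {μ : Measure G} [μ.IsAddLeftInvariant] [μ.IsNegInvariant]
    [SFinite μ] {B : Set G} (hB : MeasurableSet B) {k : G → ℝ≥0∞} (hk : Measurable k) :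
    ∫⁻ x in B, ∫⁻ y in Bᶜ, k (x - y) ∂μ ∂μ = ∫⁻ z, k z * μ {x | x ∈ B ∧ x - z ∉ B} ∂μ := by
  have hS : MeasurableSet {p : G × G | p.1 ∈ B ∧ p.1 - p.2 ∉ B} :=
    (measurable_fst hB).inter ((measurable_fst.sub measurable_snd) hB).compl
  calc ∫⁻ x in B, ∫⁻ y in Bᶜ, k (x - y) ∂μ ∂μ
      = ∫⁻ x, ∫⁻ z, {p : G × G | p.1 ∈ B ∧ p.1 - p.2 ∉ B}.indicator (fun p => k p.2) (x, z)
          ∂μ ∂μ := by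
        rw [← lintegral_indicator hB]
        congr 1 with x
        by_cases hx : x ∈ B
        · rw [indicator_of_mem hx, ← lintegral_indicator hB.compl,
            ← lintegral_sub_left_eq_self _ x]
          congr 1 with z
          by_cases hz : x - z ∈ B <;> simp [indicator, hx, hz]
        · simp [indicator, hx]
    _ = ∫⁻ z, ∫⁻ x, {p : G × G | p.1 ∈ B ∧ p.1 - p.2 ∉ B}.indicator (fun p => k p.2) (x, z)
          ∂μ ∂μ :=
        lintegral_lintegral_swap ((hk.comp measurable_snd).indicator hS).aemeasurable
    _ = _ := by
        congr 1 with z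
        exact lintegral_indicator_const (s := {x | x ∈ B ∧ x - z ∉ B})
          (measurable_prodMk_right hS) (k z)

lemma integrable_norm_rpow_mul_min {E : Type*} [NormedAddCommGroup E] [NormedSpace ℝ E]
    [FiniteDimensional ℝ E] [Nontrivial E] [MeasurableSpace E] [BorelSpace E] (μ : Measure E)
    [μ.IsAddHaarMeasure] {α θ : ℝ} (hα : 0 < α) (hθ : α < θ) :
    Integrable (fun z : E => ‖z‖ ^ (-(Module.finrank ℝ E : ℝ) - α) * min (‖z‖ ^ θ) 1) μ := by
  rw [integrable_fun_norm_addHaar μ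
    (f := fun y => y ^ (-(Module.finrank ℝ E : ℝ) - α) * min (y ^ θ) 1)]
  have hd : ((Module.finrank ℝ E - 1 : ℕ) : ℝ) = Module.finrank ℝ E - 1 := by
    rw [Nat.cast_sub Module.finrank_pos, Nat.cast_one]
  have hpow : ∀ y : ℝ, 0 < y → y ^ (Module.finrank ℝ E - 1) •
      (y ^ (-(Module.finrank ℝ E : ℝ) - α) * min (y ^ θ) 1) = y ^ (-1 - α) * min (y ^ θ) 1 := by
    intro y hy
    rw [smul_eq_mul, ← mul_assoc, ← Real.rpow_natCast, ← Real.rpow_add hy, hd]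
    ring_nf
  rw [← Ioc_union_Ioi_eq_Ioi zero_le_one, integrableOn_union]
  constructor
  · rw [integrableOn_Ioc_iff_integrableOn_Ioo]
    refine ((intervalIntegral.integrableOn_Ioo_rpow_iff (s := -1 - α + θ) one_pos).2
      (by linarith)).congr_fun (fun y hy => ?_) measurableSet_Ioo
    simp only
    rw [hpow y hy.1, min_eq_left (Real.rpow_le_one hy.1.le hy.2.le (by linarith)),
      ← Real.rpow_add hy.1]
  · refine (integrableOn_Ioi_rpow_of_lt (a := -1 - α) (by linarith) one_pos).congr_fun
      (fun y (hy : 1 < y) => ?_) measurableSet_Ioi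
    simp only
    rw [hpow y (by linarith), min_eq_right (Real.one_le_rpow hy.le (by linarith)), mul_one]

lemma min_div_one_le_rpow_mul_min {t r θ : ℝ} (ht : 0 ≤ t) (hr₀ : 0 < r) (hr₁ : r ≤ 1)
    (hθ₀ : 0 < θ) (hθ₁ : θ ≤ 1) : min (t / r) 1 ≤ r ^ (-θ) * min (t ^ θ) 1 := by
  have hrθ : 1 ≤ r ^ (-θ) := Real.one_le_rpow_of_pos_of_le_one_of_nonpos hr₀ hr₁ (by linarith)
  rw [mul_min_of_nonneg _ _ (by positivity), mul_one]
  refine le_min ?_ ((min_le_right _ _).trans hrθ)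
  have h : r ^ (-θ) * t ^ θ = (t / r) ^ θ := by
    rw [Real.div_rpow ht hr₀.le, Real.rpow_neg hr₀.le]
    field_simp
  rw [h]
  have h₀ : 0 ≤ t / r := by positivity
  rcases le_total (t / r) 1 with h₁ | h₁
  · exact (min_le_left _ _).trans (Real.self_le_rpow_of_le_one h₀ h₁ hθ₁)
  · exact (min_le_right _ _).trans (Real.one_le_rpow h₁ hθ₀.le)

lemma perK_periodic_balls_le {α θ Λ r : ℝ} (hα : 0 < α) (hαθ : α < θ) (hθ : θ ≤ 1) (hΛ : 0 < Λ)
    (hr₀ : 0 < r) (hr₁ : r ≤ 1) {K : ℝ × EuclideanSpace ℝ (Fin m) → ℝ}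
    (hK : ∀ x, x ≠ 0 → K x ≤ Λ * euclNorm x ^ (-((m : ℝ) + 1) - α)) :
    perK K {x | ∃ k : ℤ, Real.sqrt ((x.1 - 2 * π * (k : ℝ)) ^ 2 + ‖x.2‖ ^ 2) < r} ≤
      ENNReal.ofReal (Λ * (2 * (m + 1)) *
        (∫ z : ℝ × EuclideanSpace ℝ (Fin m),
          ‖z‖ ^ (-((m : ℝ) + 1) - α) * min (‖z‖ ^ θ) 1) * r ^ (-θ)) *
        volume {x : ℝ × EuclideanSpace ℝ (Fin m) | euclNorm x < r} := by
  set B := {x : ℝ × EuclideanSpace ℝ (Fin m) | euclNorm x < r}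
  have hB : MeasurableSet B := measurableSet_euclNorm_lt r
  set E := {x : ℝ × EuclideanSpace ℝ (Fin m) |
    ∃ k : ℤ, Real.sqrt ((x.1 - 2 * π * (k : ℝ)) ^ 2 + ‖x.2‖ ^ 2) < r}
  have hBE : B ⊆ E := fun x hx => ⟨0, by simpa [B, euclNorm] using hx⟩
  have hEB : E ∩ {x | -π < x.1 ∧ x.1 < π} ⊆ B := by
    rintro x ⟨⟨k, hk⟩, hx₁, hx₂⟩
    have habs : |x.1 - 2 * π * k| < r :=
      (Real.abs_le_sqrt (by nlinarith [sq_nonneg ‖x.2‖])).trans_lt hk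
    rw [abs_lt] at habs
    have hπ := Real.pi_gt_three
    have hk₁ : (k : ℝ) < 1 := by
      by_contra! h
      nlinarith
    have hk₂ : (-1 : ℝ) < k := by
      by_contra! h
      nlinarith
    have hk₀ : k = 0 := by
      have h₁ : k < 1 := by exact_mod_cast hk₁
      have h₂ : -1 < k := by exact_mod_cast hk₂
      omega
    simpa [B, euclNorm, hk₀] using hk
  set g : ℝ × EuclideanSpace ℝ (Fin m) → ℝ :=
    fun z => ‖z‖ ^ (-((m : ℝ) + 1) - α) * min (‖z‖ ^ θ) 1
  have hg : Integrable g := by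
    have := integrable_norm_rpow_mul_min
      (volume : Measure (ℝ × EuclideanSpace ℝ (Fin m))) hα hαθ
    rw [finrank_real_prod_euclideanSpace] at this
    simpa only [Nat.cast_add, Nat.cast_one] using this
  have hg₀ : ∀ z, 0 ≤ g z := fun z => by positivity
  have hr : 0 ≤ r ^ (-θ) := by positivity
  calc perK K E
      ≤ ∫⁻ x in B, ∫⁻ y in Bᶜ, ENNReal.ofReal (K (x - y)) :=
        (lintegral_mono_set hEB).trans
          (lintegral_mono fun x => lintegral_mono_set (compl_subset_compl.2 hBE))
    _ ≤ ∫⁻ x in B, ∫⁻ y in Bᶜ, ENNReal.ofReal (Λ * ‖x - y‖ ^ (-((m : ℝ) + 1) - α)) := by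
        refine setLIntegral_mono' hB fun x hx => setLIntegral_mono' hB.compl fun y hy => ?_
        have hxy : x - y ≠ 0 := sub_ne_zero.2 fun h => hy (h ▸ hx)
        refine ENNReal.ofReal_le_ofReal ((hK _ hxy).trans ?_)
        gcongr ?_ * ?_
        exact Real.rpow_le_rpow_of_nonpos (norm_pos_iff.2 hxy) (norm_le_euclNorm _)
          (by linarith [(Nat.cast_nonneg m : (0 : ℝ) ≤ m)])
    _ = ∫⁻ z, ENNReal.ofReal (Λ * ‖z‖ ^ (-((m : ℝ) + 1) - α)) *
          volume {x | x ∈ B ∧ x - z ∉ B} :=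
        setLIntegral_setLIntegral_compl_sub hB
          (k := fun z => ENNReal.ofReal (Λ * ‖z‖ ^ (-((m : ℝ) + 1) - α)))
          (by fun_prop)
    _ ≤ ∫⁻ z, ENNReal.ofReal (Λ * (2 * (m + 1)) * r ^ (-θ) * g z) * volume B := by
        refine lintegral_mono fun z => ?_
        refine (mul_le_mul_right (volume_ball_diff_translate_le hr₀ z) _).trans ?_
        rw [← mul_assoc, ← ENNReal.ofReal_mul (by positivity)]
        gcongr ENNReal.ofReal ?_ * _
        have h := min_div_one_le_rpow_mul_min (norm_nonneg z) hr₀ hr₁ (hα.trans hαθ) hθ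
        calc _ = Λ * (2 * (m + 1)) * ‖z‖ ^ (-((m : ℝ) + 1) - α) * min (‖z‖ / r) 1 := by ring
          _ ≤ Λ * (2 * (m + 1)) * ‖z‖ ^ (-((m : ℝ) + 1) - α) *
              (r ^ (-θ) * min (‖z‖ ^ θ) 1) := by gcongr
          _ = _ := by ring
    _ = _ := by
        rw [lintegral_mul_const' _ _ (volume_euclNorm_lt_ne_top r),
          ← ofReal_integral_eq_lintegral_ofReal (hg.const_mul _)
            (ae_of_all _ fun z => by have := hg₀ z; positivity), integral_const_mul]
        congr 2
        ring

lemma le_perK_cylinder (hm : 1 ≤ m) {α lam R : ℝ} (hα : 0 < α) (hlam : 0 < lam) (hR : 0 < R)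
    {K : ℝ × EuclideanSpace ℝ (Fin m) → ℝ}
    (hK : ∀ x, x ≠ 0 → lam * euclNorm x ^ (-((m : ℝ) + 1) - α) ≤ K x) :
    ENNReal.ofReal (lam * 4 ^ (-((m : ℝ) + 1) - α) * 2 *
        (volume (Metric.ball (0 : EuclideanSpace ℝ (Fin m)) 1)).toReal * R ^ (-α)) *
      volume ({x : ℝ × EuclideanSpace ℝ (Fin m) | ‖x.2‖ < R} ∩ {x | -π < x.1 ∧ x.1 < π}) ≤
    perK K {x | ‖x.2‖ < R} := by
  set v := (volume (Metric.ball (0 : EuclideanSpace ℝ (Fin m)) 1)).toReal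
  have hv : volume (Metric.ball (0 : EuclideanSpace ℝ (Fin m)) 1) = ENNReal.ofReal v :=
    (ENNReal.ofReal_toReal measure_ball_lt_top.ne).symm
  have hv₀ : 0 ≤ v := ENNReal.toReal_nonneg
  have hC : MeasurableSet ({x : ℝ × EuclideanSpace ℝ (Fin m) | ‖x.2‖ < R} ∩
      {x | -π < x.1 ∧ x.1 < π}) :=
    (measurableSet_lt (by fun_prop) measurable_const).inter
      ((measurableSet_lt measurable_const measurable_fst).inter
        (measurableSet_lt measurable_fst measurable_const))
  have hball : ∀ s : ℝ, 0 < s → volume (Metric.ball (0 : EuclideanSpace ℝ (Fin m)) s) =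
      ENNReal.ofReal (s ^ m * v) := fun s hs => by
    rw [Measure.addHaar_ball_of_pos _ _ hs, hv, ← ENNReal.ofReal_mul (by positivity)]
    simp
  have hannulus : ENNReal.ofReal (R ^ m * v) ≤
      volume (Metric.ball (0 : EuclideanSpace ℝ (Fin m)) (2 * R) \ Metric.ball 0 R) := by
    refine le_trans ?_ (le_measure_sdiff (μ := volume))
    rw [hball _ (by positivity), hball _ hR, ← ENNReal.ofReal_sub _ (by positivity)]
    refine ENNReal.ofReal_le_ofReal ?_
    have h2 : (2 : ℝ) ≤ 2 ^ m := le_self_pow₀ one_le_two (by omega)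
    have hRv : 0 ≤ R ^ m * v := by positivity
    rw [mul_pow]
    nlinarith
  have hexp : -((m : ℝ) + 1) - α ≤ 0 := by linarith [(Nat.cast_nonneg m : (0 : ℝ) ≤ m)]
  rw [← setLIntegral_const]
  refine setLIntegral_mono' hC fun x hx => ?_
  have hx₂ : ‖x.2‖ < R := hx.1
  set S : Set (ℝ × EuclideanSpace ℝ (Fin m)) :=
    Ioo (x.1 - R) (x.1 + R) ×ˢ (Metric.ball 0 (2 * R) \ Metric.ball 0 R)
  have hS : MeasurableSet S :=
    measurableSet_Ioo.prod (measurableSet_ball.diff measurableSet_ball)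
  have hSC : S ⊆ {x : ℝ × EuclideanSpace ℝ (Fin m) | ‖x.2‖ < R}ᶜ := by
    rintro y ⟨-, -, hy⟩ hy'
    exact hy (mem_ball_zero_iff.2 hy')
  have hRpow : (4 * R) ^ (-((m : ℝ) + 1) - α) * (2 * R * (R ^ m * v)) =
      4 ^ (-((m : ℝ) + 1) - α) * 2 * v * R ^ (-α) := by
    have : R ^ (-α) = R ^ (-((m : ℝ) + 1) - α) * (R * R ^ m) := by
      rw [← pow_succ', ← Real.rpow_natCast, ← Real.rpow_add hR]
      push_cast
      ring_nf
    rw [this, Real.mul_rpow (by norm_num) hR.le]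
    ring
  calc ENNReal.ofReal (lam * 4 ^ (-((m : ℝ) + 1) - α) * 2 * v * R ^ (-α))
      = ENNReal.ofReal (lam * (4 * R) ^ (-((m : ℝ) + 1) - α)) *
          (ENNReal.ofReal (2 * R) * ENNReal.ofReal (R ^ m * v)) := by
        rw [← ENNReal.ofReal_mul (by positivity), ← ENNReal.ofReal_mul (by positivity)]
        congr 1
        linear_combination -lam * hRpow
    _ ≤ ENNReal.ofReal (lam * (4 * R) ^ (-((m : ℝ) + 1) - α)) * volume S := by
        rw [Measure.volume_eq_prod, Measure.prod_prod, Real.volume_Ioo]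
        gcongr
        linarith
    _ = ∫⁻ y in S, ENNReal.ofReal (lam * (4 * R) ^ (-((m : ℝ) + 1) - α)) :=
        (setLIntegral_const _ _).symm
    _ ≤ ∫⁻ y in S, ENNReal.ofReal (K (x - y)) := by
        refine setLIntegral_mono' hS fun y hy => ENNReal.ofReal_le_ofReal ?_
        have hxy : x - y ≠ 0 := sub_ne_zero.2 fun h => hSC hy (h ▸ hx₂)
        refine le_trans ?_ (hK _ hxy)
        gcongr ?_ * ?_
        refine Real.rpow_le_rpow_of_nonpos
          ((norm_pos_iff.2 hxy).trans_le (norm_le_euclNorm _)) ?_ hexp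
        have hy₁ : |x.1 - y.1| ≤ R :=
          abs_le.2 ⟨by linarith [hy.1.2], by linarith [hy.1.1]⟩
        have hy₂ : ‖y.2‖ < 2 * R := mem_ball_zero_iff.1 hy.2.1
        have h₁ := euclNorm_le_add (x - y)
        have h₂ := norm_sub_le x.2 y.2
        rw [Prod.fst_sub, Prod.snd_sub] at h₁
        linarith
    _ ≤ _ := lintegral_mono_set hSC

lemma volume_cylinder {R : ℝ} (hR : 0 < R) :
    volume ({x : ℝ × EuclideanSpace ℝ (Fin m) | ‖x.2‖ < R} ∩ {x | -π < x.1 ∧ x.1 < π}) =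
      ENNReal.ofReal (2 * π *
        (R ^ m * (volume (Metric.ball (0 : EuclideanSpace ℝ (Fin m)) 1)).toReal)) := by
  have h : {x : ℝ × EuclideanSpace ℝ (Fin m) | ‖x.2‖ < R} ∩ {x | -π < x.1 ∧ x.1 < π} =
      Ioo (-π) π ×ˢ Metric.ball 0 R := by
    ext x
    simp [and_comm]
  rw [h, Measure.volume_eq_prod, Measure.prod_prod, Real.volume_Ioo,
    Measure.addHaar_ball_of_pos _ _ hR,
    ENNReal.ofReal_mul (p := 2 * π) (by positivity),
    ENNReal.ofReal_mul (p := R ^ m) (by positivity), ENNReal.ofReal_toReal measure_ball_lt_top.ne]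
  simp [two_mul]

end Nonlocal

theorem stmt19 (m : ℕ) (hm : 1 ≤ m) (α lam Λ : ℝ) (hα : α ∈ Set.Ioo (0:ℝ) 1)
    (hlam : 0 < lam) (hΛ : 0 < Λ) (hle : lam ≤ Λ) :
    ∃ ω₀ : ℝ, 0 < ω₀ ∧
      ∀ K : ℝ × EuclideanSpace ℝ (Fin m) → ℝ, Measurable K →
      (∀ x : ℝ × EuclideanSpace ℝ (Fin m), x ≠ 0 →
        lam * (Real.sqrt (x.1 ^ 2 + ‖x.2‖ ^ 2)) ^ (-((m : ℝ) + 1) - α) ≤ K x ∧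
        K x ≤ Λ * (Real.sqrt (x.1 ^ 2 + ‖x.2‖ ^ 2)) ^ (-((m : ℝ) + 1) - α)) →
      ∀ ω : ℝ, 0 < ω → ω < ω₀ →
      ∀ r R : ℝ, 0 < r → 0 < R →
      -- the ball of radius `r` centered at `0` has volume `ω`
      volume {x : ℝ × EuclideanSpace ℝ (Fin m) |
          Real.sqrt (x.1 ^ 2 + ‖x.2‖ ^ 2) < r} = ENNReal.ofReal ω →
      -- the straight cylinder of radius `R` has volume `ω` in the slab `Ω`
      volume ({x : ℝ × EuclideanSpace ℝ (Fin m) | ‖x.2‖ < R} ∩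
          {x : ℝ × EuclideanSpace ℝ (Fin m) | -π < x.1 ∧ x.1 < π}) =
        ENNReal.ofReal ω →
      perK K {x : ℝ × EuclideanSpace ℝ (Fin m) |
          ∃ k : ℤ, Real.sqrt ((x.1 - 2 * π * (k : ℝ)) ^ 2 + ‖x.2‖ ^ 2) < r} <
        perK K {x : ℝ × EuclideanSpace ℝ (Fin m) | ‖x.2‖ < R} := by
  obtain ⟨hα₀, hα₁⟩ := hα
  have hm₀ : (0 : ℝ) < m := by exact_mod_cast hm
  set β : ℝ := α * (m + 1) / m with hβ
  have hαβ : α < β := by rw [hβ, lt_div_iff₀ hm₀]; nlinarith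
  obtain ⟨θ, hαθ, hθ⟩ := exists_between (lt_min hα₁ hαβ)
  have hθ₁ : θ ≤ 1 := (hθ.trans_le (min_le_left _ _)).le
  have hθβ : 0 < β - θ := sub_pos.2 (hθ.trans_le (min_le_right _ _))
  set b := (volume {x : ℝ × EuclideanSpace ℝ (Fin m) | euclNorm x < 1}).toReal
  set v := (volume (Metric.ball (0 : EuclideanSpace ℝ (Fin m)) 1)).toReal
  have hb₀ : 0 < b :=
    ENNReal.toReal_pos volume_euclNorm_lt_one_pos.ne' (volume_euclNorm_lt_ne_top 1)
  have hv₀ : 0 < v :=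
    ENNReal.toReal_pos (Metric.measure_ball_pos _ _ one_pos).ne' measure_ball_lt_top.ne
  set A := Λ * (2 * (m + 1)) * ∫ z : ℝ × EuclideanSpace ℝ (Fin m),
    ‖z‖ ^ (-((m : ℝ) + 1) - α) * min (‖z‖ ^ θ) 1
  set a := lam * 4 ^ (-((m : ℝ) + 1) - α) * 2 * v
  have ha : 0 < a := by positivity
  set D := (b / (2 * π * v)) ^ (α / m)
  have hlim : Filter.Tendsto (fun r : ℝ => A * D * r ^ (β - θ)) (nhds 0) (nhds 0) := by
    have h := ((Real.continuous_rpow_const hθβ.le).tendsto 0).const_mul (A * D)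
    rwa [Real.zero_rpow hθβ.ne', mul_zero] at h
  obtain ⟨ε, hε, hsmall⟩ := Metric.eventually_nhds_iff.1 (hlim.eventually_lt_const ha)
  set r₀ := min ε 1
  have hr₀ : 0 < r₀ := lt_min hε one_pos
  refine ⟨r₀ ^ (m + 1) * b, by positivity, fun K _ hK ω hω hω₀ r R hr hR hball hcyl => ?_⟩
  have hωr : ω = r ^ (m + 1) * b := by
    have h := volume_euclNorm_lt (m := m) hr.le
    rw [← ENNReal.ofReal_toReal (volume_euclNorm_lt_ne_top (m := m) 1),
      ← ENNReal.ofReal_mul (by positivity)] at h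
    exact (ENNReal.ofReal_eq_ofReal_iff hω.le (by positivity)).1 (hball.symm.trans h)
  have hωR : ω = 2 * π * (R ^ m * v) :=
    (ENNReal.ofReal_eq_ofReal_iff hω.le (by positivity)).1
      (hcyl.symm.trans (volume_cylinder hR))
  have hrr₀ : r < r₀ := by
    rw [hωr] at hω₀
    exact lt_of_pow_lt_pow_left₀ _ hr₀.le (lt_of_mul_lt_mul_right hω₀ hb₀.le)
  have hRr : R ^ α = D * r ^ β := by
    have h : R ^ m = b / (2 * π * v) * r ^ (m + 1) := by
      field_simp
      linarith
    calc R ^ α = (R ^ m) ^ (α / m) := by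
          rw [← Real.rpow_natCast, ← Real.rpow_mul hR.le, mul_div_cancel₀ _ hm₀.ne']
      _ = D * r ^ β := by
          rw [h, Real.mul_rpow (by positivity) (by positivity), ← Real.rpow_natCast,
            ← Real.rpow_mul hr.le, hβ]
          congr 2
          push_cast
          ring
  have hkey : A * r ^ (-θ) < a * R ^ (-α) := by
    have h : A * D * r ^ (β - θ) < a :=
      hsmall (by rw [Real.dist_0_eq_abs, abs_of_pos hr]; exact hrr₀.trans_le (min_le_left _ _))
    rw [Real.rpow_neg hR.le, ← div_eq_mul_inv, lt_div_iff₀ (by positivity), hRr]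
    rw [sub_eq_neg_add, Real.rpow_add hr] at h
    linarith
  calc _ ≤ ENNReal.ofReal (A * r ^ (-θ)) * ENNReal.ofReal ω :=
        hball ▸ perK_periodic_balls_le hα₀ hαθ hθ₁ hΛ hr
          (hrr₀.le.trans (min_le_right _ _)) fun x hx => (hK x hx).2
    _ < ENNReal.ofReal (a * R ^ (-α)) * ENNReal.ofReal ω := by
        refine ENNReal.mul_lt_mul_left (ENNReal.ofReal_pos.2 hω).ne' ENNReal.ofReal_ne_top ?_
        exact (ENNReal.ofReal_lt_ofReal_iff (by positivity)).2 hkey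
    _ ≤ _ := hcyl ▸ le_perK_cylinder hm hα₀ hlam hR fun x hx => (hK x hx).1
end
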